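/- arXiv:2101.08217 — 5 statements merged into one kernel-verified Lean document; each statement's English description precedes it below -/
import Mathlib

section
/- Let G be a finite simple graph with at least seven vertices such that for any three distinct vertices v₁, v₂, v₃, at least two of them are joined by an edge. Then G contains two distinct 3-cycles that share an edge; that is, there exist vertices a, b, c, d with c ≠ d such that the pairs {a,b}, {a,c}, {b,c}, {a,d}, {b,d} are all edges of G. -/
theorem Finset.exists_four_of_three_lt_card {α : Type*} {s : Finset α} (hs : 3 < s.card) :
    ∃ a b c d, a ∈ s ∧ b ∈ s ∧ c ∈ s ∧ d ∈ s ∧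
      a ≠ b ∧ a ≠ c ∧ a ≠ d ∧ b ≠ c ∧ b ≠ d ∧ c ≠ d := by
  classical
  obtain ⟨a, ha⟩ := Finset.card_pos.mp (by omega : 0 < s.card)
  have hcard : 2 < (s.erase a).card := by rw [Finset.card_erase_of_mem ha]; omega
  obtain ⟨b, hb, c, hc, d, hd, hbc, hbd, hcd⟩ := Finset.two_lt_card.mp hcard
  rw [Finset.mem_erase] at hb hc hd
  exact ⟨a, b, c, d, ha, hb.2, hc.2, hd.2, hb.1.symm, hc.1.symm, hd.1.symm, hbc, hbd, hcd⟩

namespace SimpleGraph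

variable {V : Type*} {G : SimpleGraph V}

/-- No four distinct neighbours `p, q, r, s` of `v` with `p` adjacent to `q`, if there is a sixth
vertex `x`, no independent triple, and no two triangles sharing an edge. -/
theorem false_of_four_neighbors_of_adj
    (h : ∀ a b c : V, a ≠ b → a ≠ c → b ≠ c → G.Adj a b ∨ G.Adj a c ∨ G.Adj b c)
    (hG : ∀ a b c d : V, c ≠ d → G.Adj a b → G.Adj a c → G.Adj b c → G.Adj a d → ¬ G.Adj b d)
    {v p q r s x : V} (hp : G.Adj v p) (hq : G.Adj v q) (hr : G.Adj v r) (hs : G.Adj v s)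
    (hpr : p ≠ r) (hps : p ≠ s) (hqr : q ≠ r) (hqs : q ≠ s) (hrs : r ≠ s)
    (hxv : x ≠ v) (hxp : x ≠ p) (hxq : x ≠ q) (hxr : x ≠ r) (hxs : x ≠ s)
    (hpq : G.Adj p q) : False := by
  have npr : ¬ G.Adj p r := hG v p q r hqr hp hq hpq hr
  have nps : ¬ G.Adj p s := hG v p q s hqs hp hq hpq hs
  have nqr : ¬ G.Adj q r := hG v q p r hpr hq hp hpq.symm hr
  have nqs : ¬ G.Adj q s := hG v q p s hps hq hp hpq.symm hs
  have ars : G.Adj r s := by simpa [npr, nps] using h p r s hpr hps hrs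
  have h₁ : ¬ (G.Adj x p ∧ G.Adj x q) := fun hx =>
    hG p q v x hxv.symm hpq hp.symm hq.symm hx.1.symm hx.2.symm
  have h₂ : ¬ (G.Adj x r ∧ G.Adj x s) := fun hx =>
    hG r s v x hxv.symm ars hr.symm hs.symm hx.1.symm hx.2.symm
  have := h x p r hxp hxr hpr
  have := h x p s hxp hxs hps
  have := h x q r hxq hxr hqr
  have := h x q s hxq hxs hqs
  tauto

theorem degree_le_three [Fintype V] [DecidableRel G.Adj] (hcard : 6 ≤ Fintype.card V)
    (h : ∀ a b c : V, a ≠ b → a ≠ c → b ≠ c → G.Adj a b ∨ G.Adj a c ∨ G.Adj b c)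
    (hG : ∀ a b c d : V, c ≠ d → G.Adj a b → G.Adj a c → G.Adj b c → G.Adj a d → ¬ G.Adj b d)
    (v : V) : G.degree v ≤ 3 := by
  classical
  by_contra! hv
  obtain ⟨p, q, r, s, hp, hq, hr, hs, hpq, hpr, hps, hqr, hqs, hrs⟩ :=
    Finset.exists_four_of_three_lt_card hv
  rw [mem_neighborFinset] at hp hq hr hs
  have hlt : ({v, p, q, r, s} : Finset V).card < Fintype.card V :=
    Finset.card_le_five.trans_lt hcard
  obtain ⟨x, hx⟩ : ∃ x, x ∉ ({v, p, q, r, s} : Finset V) := by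
    by_contra! hall
    exact hlt.ne (Finset.card_eq_iff_eq_univ _ |>.mpr (Finset.eq_univ_iff_forall.mpr hall))
  simp only [Finset.mem_insert, Finset.mem_singleton, not_or] at hx
  obtain ⟨hxv, hxp, hxq, hxr, hxs⟩ := hx
  rcases h p q r hpq hpr hqr with e | e | e
  · exact false_of_four_neighbors_of_adj h hG hp hq hr hs hpr hps hqr hqs hrs
      hxv hxp hxq hxr hxs e
  · exact false_of_four_neighbors_of_adj h hG hp hr hq hs hpq hps hqr.symm hrs hqs
      hxv hxp hxr hxq hxs e
  · exact false_of_four_neighbors_of_adj h hG hq hr hp hs hpq.symm hqs hpr.symm hrs hps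
      hxv hxq hxr hxp hxs e

theorem card_le_degree_add_four [Fintype V] [DecidableRel G.Adj]
    (h : ∀ a b c : V, a ≠ b → a ≠ c → b ≠ c → G.Adj a b ∨ G.Adj a c ∨ G.Adj b c)
    (hG : ∀ a b c d : V, c ≠ d → G.Adj a b → G.Adj a c → G.Adj b c → G.Adj a d → ¬ G.Adj b d)
    (v : V) : Fintype.card V ≤ G.degree v + 4 := by
  classical
  by_contra! hv
  have hcompl := G.degree_compl v
  have hlt : 3 < (Gᶜ.neighborFinset v).card := by
    rw [card_neighborFinset_eq_degree]; omega
  obtain ⟨p, q, r, s, hp, hq, hr, hs, hpq, hpr, hps, hqr, hqs, hrs⟩ :=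
    Finset.exists_four_of_three_lt_card hlt
  rw [mem_neighborFinset, compl_adj] at hp hq hr hs
  have adj {a b : V} (ha : v ≠ a ∧ ¬ G.Adj v a) (hb : v ≠ b ∧ ¬ G.Adj v b) (hab : a ≠ b) :
      G.Adj a b := by
    simpa [ha.2, hb.2] using h v a b ha.1 hb.1 hab
  exact hG p q r s hrs (adj hp hq hpq) (adj hp hr hpr) (adj hq hr hqr) (adj hp hs hps)
    (adj hq hs hqs)

end SimpleGraph

/-- a finite simple graph on at least 7 vertices with no three pairwise
non-adjacent vertices contains two distinct triangles sharing an edge. -/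
theorem two_triangles_sharing_edge {V : Type*} [Fintype V] (G : SimpleGraph V)
    (hcard : 7 ≤ Fintype.card V)
    (h : ∀ v₁ v₂ v₃ : V, v₁ ≠ v₂ → v₁ ≠ v₃ → v₂ ≠ v₃ →
      G.Adj v₁ v₂ ∨ G.Adj v₁ v₃ ∨ G.Adj v₂ v₃) :
    ∃ a b c d : V, c ≠ d ∧ G.Adj a b ∧ G.Adj a c ∧ G.Adj b c ∧
      G.Adj a d ∧ G.Adj b d := by
  classical
  by_contra! hG
  have hle := SimpleGraph.degree_le_three (by omega) h hG
  have hge := SimpleGraph.card_le_degree_add_four h hG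
  have hdeg : ∀ v, G.degree v = 3 := fun v => by
    have := hle v
    have := hge v
    omega
  obtain ⟨v⟩ : Nonempty V := Fintype.card_pos_iff.mp (by omega)
  have hseven : Fintype.card V = 7 := by
    have := hge v
    have := hdeg v
    omega
  have hsum := G.sum_degrees_eq_twice_card_edges
  simp only [hdeg, Finset.sum_const, Finset.card_univ, hseven, smul_eq_mul] at hsum
  omega
end

section
/- Let k be a perfect field with algebraic closure k̄, and let f be a nonzero homogeneous polynomial of degree 3 in four variables over k defining a smooth cubic surface. Let W₁, W₂, W₃ be three distinct lines on V(f) over k̄ that are coplanar, i.e., all contained in a common 3-dimensional k̄-linear subspace of k̄⁴. If W₁ and W₂ are defined over k, then W₃ is also defined over k. -/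
open MvPolynomial

/-- The restriction of `f` to the line spanned by `v` and `w`:
the polynomial `f (s • v + t • w)` in the two variables `s, t`. -/
noncomputable def lineRestrict {k : Type*} [CommRing k] (f : MvPolynomial (Fin 4) k)
    (v w : Fin 4 → k) : MvPolynomial (Fin 2) k :=
  aeval (fun i => C (v i) * X 0 + C (w i) * X 1) f

/-- `W` is a line on the cubic surface `V(f)` defined over `k`: a 2-dimensional
`k`-linear subspace of `k⁴` on which `f` vanishes identically as a polynomial. -/
def IsLineOn {k : Type*} [Field k] (f : MvPolynomial (Fin 4) k)
    (W : Submodule k (Fin 4 → k)) : Prop :=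
  Module.finrank k W = 2 ∧
    ∃ v w : Fin 4 → k, Submodule.span k {v, w} = W ∧ lineRestrict f v w = 0

/-- `f` defines a smooth cubic surface over `k`: `f` is a nonzero homogeneous cubic
and, over an algebraic closure, the only common zero of `f` and its partial
derivatives is the origin. -/
def IsSmoothCubic (k : Type*) [Field k] (f : MvPolynomial (Fin 4) k) : Prop :=
  f ≠ 0 ∧ f.IsHomogeneous 3 ∧
    ∀ x : Fin 4 → AlgebraicClosure k,
      (eval x (map (algebraMap k (AlgebraicClosure k)) f) = 0 ∧
        ∀ i : Fin 4, eval x (map (algebraMap k (AlgebraicClosure k)) (pderiv i f)) = 0) →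
      x = 0

/-- `W` is defined over `k` (inside the `K`-points): `W` is the `K`-span of the image
of a `k`-subspace of `k⁴`. -/
def DefinedOver (k : Type*) {K : Type*} [Field k] [Field K] [Algebra k K]
    (W : Submodule K (Fin 4 → K)) : Prop :=
  ∃ W₀ : Submodule k (Fin 4 → k),
    W = Submodule.span K
      ((fun (v : Fin 4 → k) (i : Fin 4) => algebraMap k K (v i)) '' (W₀ : Set (Fin 4 → k)))

namespace MvPolynomial

lemma IsHomogeneous.eval_smul {σ R : Type*} [CommSemiring R] {φ : MvPolynomial σ R} {n : ℕ}
    (hφ : φ.IsHomogeneous n) (r : R) (x : σ → R) :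
    eval (r • x) φ = r ^ n * eval x φ := by
  rw [eval_eq, eval_eq, Finset.mul_sum]
  refine Finset.sum_congr rfl fun d hd ↦ ?_
  have h : ∏ i ∈ d.support, r ^ d i = r ^ n := by
    rw [Finset.prod_pow_eq_pow_sum, hφ.degree_eq_sum_deg_support hd]
  simp only [Pi.smul_apply, smul_eq_mul, mul_pow, Finset.prod_mul_distrib, h]
  ring

/-- The restriction of a polynomial to the affine line `t ↦ p + t • d`. -/
noncomputable def restrictAffineLine {σ R : Type*} [CommRing R] (p d : σ → R) :
    MvPolynomial σ R →ₐ[R] Polynomial R :=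
  aeval fun i ↦ Polynomial.C (p i) + Polynomial.C (d i) * Polynomial.X

lemma eval_restrictAffineLine {σ R : Type*} [CommRing R] (p d : σ → R) (φ : MvPolynomial σ R)
    (t : R) : (restrictAffineLine p d φ).eval t = eval (p + t • d) φ := by
  have h : (Polynomial.aeval t).comp (restrictAffineLine p d) = aeval (p + t • d) := by
    ext i
    simp [restrictAffineLine]
    ring
  simpa [Polynomial.aeval_def, Polynomial.eval₂_eq_eval_map, aeval_eq_eval] using
    DFunLike.congr_fun h φ

lemma derivative_restrictAffineLine {σ R : Type*} [CommRing R] [Fintype σ] (p d : σ → R)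
    (φ : MvPolynomial σ R) :
    (restrictAffineLine p d φ).derivative =
      ∑ i, Polynomial.C (d i) * restrictAffineLine p d (pderiv i φ) := by
  classical
  induction φ using MvPolynomial.induction_on with
  | C a => simp [restrictAffineLine]
  | add φ ψ hφ hψ => simp [hφ, hψ, mul_add, Finset.sum_add_distrib]
  | mul_X φ j hφ =>
    have hX : restrictAffineLine p d (X j) =
        Polynomial.C (p j) + Polynomial.C (d j) * Polynomial.X := by simp [restrictAffineLine]
    rw [map_mul, Polynomial.derivative_mul, hφ]
    simp only [Derivation.leibniz, pderiv_X, smul_eq_mul, map_add, map_mul, mul_add,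
      Finset.sum_add_distrib]
    rw [add_comm]
    congr 1
    · rw [Finset.sum_eq_single j (fun i _ hij ↦ by simp [hij.symm]) (by simp)]
      simp [hX]
      ring
    · rw [Finset.sum_mul]
      exact Finset.sum_congr rfl fun i _ ↦ by ring

lemma exists_eval_eq_zero_of_isHomogeneous {σ K : Type*} [Field K] [IsAlgClosed K]
    {φ : MvPolynomial σ K} {n : ℕ} (hφ : φ.IsHomogeneous n) (hn : n ≠ 0) {u v : σ → K}
    (huv : LinearIndependent K ![u, v]) :
    ∃ x ∈ Submodule.span K {u, v}, x ≠ 0 ∧ eval x φ = 0 := by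
  rw [LinearIndependent.pair_iff] at huv
  have hmem (s t : K) : s • u + t • v ∈ Submodule.span K {u, v} :=
    Submodule.mem_span_pair.2 ⟨s, t, rfl⟩
  by_cases hdeg : (restrictAffineLine v u φ).degree = 0
  · obtain ⟨c, hc⟩ : ∃ c, restrictAffineLine v u φ = Polynomial.C c :=
      ⟨_, Polynomial.eq_C_of_degree_eq_zero hdeg⟩
    have hc' (t : K) : eval (v + t • u) φ = c := by
      rw [← eval_restrictAffineLine, hc, Polynomial.eval_C]
    have key : Polynomial.X * restrictAffineLine u v φ =
        Polynomial.X * (Polynomial.X ^ n * Polynomial.C c) := by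
      refine Polynomial.funext fun t ↦ ?_
      rcases eq_or_ne t 0 with rfl | ht
      · simp
      · have : u + t • v = t • (v + t⁻¹ • u) := by
          rw [smul_add, smul_smul, mul_inv_cancel₀ ht, one_smul, add_comm]
        rw [Polynomial.eval_mul, eval_restrictAffineLine, this, hφ.eval_smul, hc']
        simp only [Polynomial.eval_mul, Polynomial.eval_X, Polynomial.eval_pow, Polynomial.eval_C]
    have h0 := congrArg (Polynomial.eval 0) (mul_left_cancel₀ Polynomial.X_ne_zero key)
    refine ⟨u, by simpa using hmem 1 0, ?_, ?_⟩
    · rintro rfl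
      simpa using huv 1 0 (by simp)
    · simpa [eval_restrictAffineLine, hn] using h0
  · obtain ⟨t, ht⟩ := IsAlgClosed.exists_root _ hdeg
    refine ⟨v + t • u, by simpa [add_comm] using hmem t 1, fun h ↦ ?_, ?_⟩
    · simpa using huv t 1 (by simpa [add_comm] using h)
    · rw [← eval_restrictAffineLine]
      exact ht

/-- A form of degree at least two that vanishes on a hyperplane is singular somewhere on it. -/
lemma exists_singular_of_vanishes_on_hyperplane {σ K : Type*} [Fintype σ] [Field K]
    [IsAlgClosed K] {φ : MvPolynomial σ K} {n : ℕ} (hφ : φ.IsHomogeneous n) (hn : 2 ≤ n)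
    {H : Submodule K (σ → K)} (hH : Module.finrank K H + 1 = Fintype.card σ)
    (hφH : ∀ x ∈ H, eval x φ = 0) {u v : σ → K} (hu : u ∈ H) (hv : v ∈ H)
    (huv : LinearIndependent K ![u, v]) :
    ∃ x ∈ H, x ≠ 0 ∧ ∀ i, eval x (pderiv i φ) = 0 := by
  classical
  have htangent {p d : σ → K} (hp : p ∈ H) (hd : d ∈ H) :
      ∑ i, d i * eval p (pderiv i φ) = 0 := by
    have h0 : restrictAffineLine p d φ = 0 := Polynomial.funext fun t ↦ by
      simpa [eval_restrictAffineLine] using hφH _ (H.add_mem hp (H.smul_mem t hd))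
    have h1 := congrArg (Polynomial.eval 0) (derivative_restrictAffineLine p d φ)
    simpa [h0, Polynomial.eval_finsetSum, eval_restrictAffineLine] using h1.symm
  have htop : H ≠ ⊤ := by
    rintro rfl
    simp at hH
  obtain ⟨e, -, he⟩ := SetLike.exists_of_lt htop.lt_top
  have hψ : (∑ i, C (e i) * pderiv i φ).IsHomogeneous (n - 1) :=
    IsHomogeneous.sum _ _ _ fun i _ ↦ hφ.pderiv.C_mul _
  obtain ⟨x, hx, hx0, hxe⟩ := exists_eval_eq_zero_of_isHomogeneous hψ (by omega) huv
  have hxH : x ∈ H := Submodule.span_le.2 (by simp [Set.insert_subset_iff, hu, hv]) hx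
  refine ⟨x, hxH, hx0, fun i ↦ ?_⟩
  let D : (σ → K) →ₗ[K] K := Fintype.linearCombination K fun i ↦ eval x (pderiv i φ)
  have hle : H < LinearMap.ker D := by
    refine SetLike.lt_iff_le_and_exists.2 ⟨fun d hd ↦ ?_, e, ?_, he⟩
    · simpa [D, Fintype.linearCombination_apply] using htangent hxH hd
    · simpa [D, Fintype.linearCombination_apply] using hxe
  have hker : LinearMap.ker D = ⊤ := by
    refine Submodule.eq_top_of_finrank_eq ?_
    have h1 := Submodule.finrank_lt_finrank_of_lt hle
    have h2 := (LinearMap.ker D).finrank_le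
    rw [Module.finrank_fintype_fun_eq_card] at h2 ⊢
    omega
  have hi : Pi.single i 1 ∈ LinearMap.ker D := hker ▸ Submodule.mem_top
  simpa [D, Fintype.linearCombination_apply_single] using hi

lemma coeff_eq_zero_of_eval_eq_zero {σ K : Type*} [Field K] [Infinite K]
    {φ : MvPolynomial σ K} {i : σ} (h : ∀ x : σ → K, x i = 0 → eval x φ = 0)
    {m : σ →₀ ℕ} (hm : m i = 0) : coeff m φ = 0 := by
  classical
  let s : σ → MvPolynomial σ K := fun j ↦ if j = i then 0 else X j
  have h0 : aeval s φ = 0 := by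
    refine MvPolynomial.funext fun x ↦ ?_
    rw [map_zero, ← h (fun j ↦ if j = i then 0 else x j) (by simp)]
    have : (aeval x).comp (aeval s) =
        aeval (R := K) (fun j ↦ if j = i then 0 else x j) := by
      ext j
      by_cases hj : j = i <;> simp [s, hj]
    simpa [aeval_eq_eval] using DFunLike.congr_fun this φ
  let I : Ideal (MvPolynomial σ K) := Ideal.span (X '' {i})
  have h1 : (Ideal.Quotient.mkₐ K I).comp (aeval s) = Ideal.Quotient.mkₐ K I := by
    ext j
    by_cases hj : j = i
    · subst hj
      have : (X j : MvPolynomial σ K) ∈ I := Ideal.subset_span (by simp)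
      simpa [s] using (Ideal.Quotient.eq_zero_iff_mem.2 this).symm
    · simp [s, hj]
  have hmem : φ ∈ I := by
    have h2 := DFunLike.congr_fun h1 φ
    rw [AlgHom.comp_apply, h0, map_zero] at h2
    exact Ideal.Quotient.eq_zero_iff_mem.1 h2.symm
  by_contra hne
  obtain ⟨j, rfl, hj⟩ := mem_ideal_span_X_image.1 hmem m (mem_support_iff.2 hne)
  exact hj hm

/-- A ternary cubic vanishing on two coordinate lines is their product with a linear form. -/
lemma exists_linear_cofactor {k K : Type*} [Field k] [Field K] [Infinite K] [Algebra k K]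
    {φ : MvPolynomial (Fin 3) k} (hφ : φ.IsHomogeneous 3)
    (h1 : ∀ x : Fin 3 → K, x 1 = 0 → aeval x φ = 0)
    (h2 : ∀ x : Fin 3 → K, x 2 = 0 → aeval x φ = 0) :
    ∃ a b c : k, ∀ x : Fin 3 → K, aeval x φ =
      x 1 * x 2 * (algebraMap k K a * x 0 + algebraMap k K b * x 1 + algebraMap k K c * x 2) := by
  have hcoeff {i : Fin 3} (h : ∀ x : Fin 3 → K, x i = 0 → aeval x φ = 0)
      {m : Fin 3 →₀ ℕ} (hm : m i = 0) : coeff m φ = 0 := by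
    refine (algebraMap k K).injective ?_
    rw [← coeff_map, map_zero]
    refine coeff_eq_zero_of_eval_eq_zero (fun x hx ↦ ?_) hm
    rw [eval_map, ← aeval_def]
    exact h x hx
  let M : Fin 3 → Fin 3 →₀ ℕ := fun i ↦
    Finsupp.single 1 1 + Finsupp.single 2 1 + Finsupp.single i 1
  have hM : Function.Injective M := fun i j hij ↦ by
    have := add_left_cancel hij
    exact (Finsupp.single_left_inj one_ne_zero).1 this
  have hsupp : φ.support ⊆ Finset.univ.image M := by
    intro m hm
    have hdeg := hφ.degree_eq_sum_deg_support hm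
    have hm1 : m 1 ≠ 0 := fun h ↦ mem_support_iff.1 hm (hcoeff h1 h)
    have hm2 : m 2 ≠ 0 := fun h ↦ mem_support_iff.1 hm (hcoeff h2 h)
    have hsum : m 0 + m 1 + m 2 = 3 := by
      refine (Fin.sum_univ_three m).symm.trans (Eq.trans ?_ hdeg.symm)
      exact (Finset.sum_subset (Finset.subset_univ _) (by simp)).symm
    have hcases : (m 0 = 1 ∧ m 1 = 1 ∧ m 2 = 1) ∨ (m 0 = 0 ∧ m 1 = 2 ∧ m 2 = 1) ∨
        (m 0 = 0 ∧ m 1 = 1 ∧ m 2 = 2) := by omega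
    rw [Finset.mem_image]
    rcases hcases with h | h | h
    · exact ⟨0, Finset.mem_univ _, by ext j; fin_cases j <;> simp [M, h]⟩
    · exact ⟨1, Finset.mem_univ _, by ext j; fin_cases j <;> simp [M, h]⟩
    · exact ⟨2, Finset.mem_univ _, by ext j; fin_cases j <;> simp [M, h]⟩
  refine ⟨coeff (M 0) φ, coeff (M 1) φ, coeff (M 2) φ, fun x ↦ ?_⟩
  rw [aeval_def, eval₂_eq', Finset.sum_subset hsupp (fun m _ hm ↦ by
    rw [notMem_support_iff.1 hm, map_zero, zero_mul]), Finset.sum_image hM.injOn]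
  simp [Fin.sum_univ_three, Fin.prod_univ_three, M]
  ring

end MvPolynomial

section BaseChange

variable {ι k K : Type*} [Field k] [Field K] [Algebra k K]

lemma span_image_algebraMap_span (s : Set (ι → k)) :
    Submodule.span K (Pi.algebraMap ι k K '' (Submodule.span k s : Set (ι → k))) =
      Submodule.span K (Pi.algebraMap ι k K '' s) := by
  rw [← Submodule.map_coe, Submodule.map_span, Submodule.span_span_of_tower]

lemma finrank_span_image_algebraMap [Finite ι] (A : Submodule k (ι → k)) :
    Module.finrank K (Submodule.span K (Pi.algebraMap ι k K '' (A : Set (ι → k)))) =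
      Module.finrank k A := by
  let b := Module.finBasis k A
  have hb : LinearIndependent k (fun i ↦ (b i : ι → k)) :=
    b.linearIndependent.map' A.subtype A.ker_subtype
  have hA : A = Submodule.span k (Set.range fun i ↦ (b i : ι → k)) := by
    have := congrArg (Submodule.map A.subtype) b.span_eq
    rw [Submodule.map_span, Submodule.map_top, A.range_subtype, ← Set.range_comp] at this
    exact this.symm
  conv_lhs => rw [hA, span_image_algebraMap_span, ← Set.range_comp]
  exact (finrank_span_eq_card
    (linearIndependent_algebraMap_comp_iff (S := K).2 hb)).trans (Fintype.card_fin _)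

lemma definedOver_of_le_span_pair {W : Submodule K (Fin 4 → K)} (hW : Module.finrank K W = 2)
    {p q : Fin 4 → k}
    (h : W ≤ Submodule.span K {Pi.algebraMap (Fin 4) k K p, Pi.algebraMap (Fin 4) k K q}) :
    DefinedOver k W := by
  classical
  refine ⟨Submodule.span k {p, q}, ?_⟩
  refine Eq.trans ?_ (span_image_algebraMap_span {p, q}).symm
  rw [Set.image_pair]
  refine Submodule.eq_of_le_of_finrank_le h ?_
  rw [hW, ← Finset.coe_pair]
  exact (finrank_span_finset_le_card _).trans Finset.card_le_two

end BaseChange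

lemma Submodule.exists_span_pair_of_finrank_eq_two {k V : Type*} [Field k] [AddCommGroup V]
    [Module k V] {P : Submodule k V} (hP : Module.finrank k P = 2) {u : V} (hu : u ∈ P)
    (hu0 : u ≠ 0) : ∃ v, P = Submodule.span k {u, v} := by
  have : FiniteDimensional k P := Module.finite_of_finrank_eq_succ hP
  have hle : Submodule.span k {u} ≤ P := by simpa using hu
  have hlt : Submodule.span k {u} < P := by
    refine lt_of_le_of_ne hle fun h ↦ ?_
    rw [← h, finrank_span_singleton hu0] at hP
    omega
  obtain ⟨v, hv, hvu⟩ := SetLike.exists_of_lt hlt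
  have hle' : Submodule.span k {u, v} ≤ P :=
    Submodule.span_le.2 (by simp [Set.insert_subset_iff, hu, hv])
  have : FiniteDimensional k (Submodule.span k {u, v}) :=
    FiniteDimensional.span_of_finite k (by simp)
  refine ⟨v, (Submodule.eq_of_le_of_finrank_le hle' ?_).symm⟩
  have h1 : Submodule.span k {u} < Submodule.span k {u, v} :=
    SetLike.lt_iff_le_and_exists.2
      ⟨Submodule.span_mono (by simp), v, Submodule.subset_span (by simp), hvu⟩
  have h2 := Submodule.finrank_lt_finrank_of_lt h1
  rw [finrank_span_singleton hu0] at h2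
  omega

/-- Two distinct planes spanning at most a 3-dimensional space have an adapted basis. -/
lemma Submodule.exists_adapted_triple {k V : Type*} [Field k] [AddCommGroup V] [Module k V]
    [FiniteDimensional k V] {P Q : Submodule k V} (hP : Module.finrank k P = 2)
    (hQ : Module.finrank k Q = 2) (hne : P ≠ Q) (hPQ : Module.finrank k ↥(P ⊔ Q) ≤ 3) :
    ∃ u v w : V, P = Submodule.span k {u, v} ∧ Q = Submodule.span k {u, w} ∧
      LinearIndependent k ![u, v, w] := by
  have hlt : P < P ⊔ Q := by
    refine lt_of_le_of_ne le_sup_left fun h ↦ hne ?_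
    exact (Submodule.eq_of_le_of_finrank_eq (sup_eq_left.1 h.symm) (hQ.trans hP.symm)).symm
  have h3 := Submodule.finrank_lt_finrank_of_lt hlt
  have hdim := Submodule.finrank_sup_add_finrank_inf_eq P Q
  have hinf : P ⊓ Q ≠ ⊥ := fun h ↦ by
    rw [h, finrank_bot] at hdim
    omega
  obtain ⟨u, hu, hu0⟩ := Submodule.exists_mem_ne_zero_of_ne_bot hinf
  obtain ⟨v, hv⟩ := exists_span_pair_of_finrank_eq_two hP hu.1 hu0
  obtain ⟨w, hw⟩ := exists_span_pair_of_finrank_eq_two hQ hu.2 hu0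
  refine ⟨u, v, w, hv, hw, ?_⟩
  rw [linearIndependent_iff_card_le_finrank_span, Fintype.card_fin, Set.finrank]
  have hspan : P ⊔ Q = Submodule.span k (Set.range ![u, v, w]) := by
    rw [hv, hw, ← Submodule.span_union]
    congr 1
    ext x
    simp
    tauto
  rw [← hspan]
  omega

lemma IsLineOn.eval_eq_zero {k : Type*} [Field k] {f : MvPolynomial (Fin 4) k}
    {W : Submodule k (Fin 4 → k)} (hW : IsLineOn f W) {x : Fin 4 → k} (hx : x ∈ W) :
    eval x f = 0 := by
  obtain ⟨-, v, w, rfl, h⟩ := hW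
  obtain ⟨s, t, rfl⟩ := Submodule.mem_span_pair.1 hx
  have h1 : (aeval ![s, t]).comp
      (aeval fun i => C (v i) * X 0 + C (w i) * X 1 : MvPolynomial (Fin 4) k →ₐ[k] _) =
        aeval (s • v + t • w) := by
    ext i
    simp
    ring
  have h2 := DFunLike.congr_fun h1 f
  rw [AlgHom.comp_apply] at h2
  change aeval (s • v + t • w) f = 0
  rw [← h2]
  exact (congrArg _ h).trans (map_zero _)

/-- Three linear forms whose product vanishes on `W`: one of them vanishes on `W`. -/
lemma Submodule.exists_forall_eq_zero_of_prod_eq_zero {K V ι : Type*} [Field K] [Infinite K]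
    [AddCommGroup V] [Module K V] [Fintype ι] (W : Submodule K V) (φ : ι → Module.Dual K V)
    (h : ∀ x ∈ W, ∏ i, φ i x = 0) : ∃ i, ∀ x ∈ W, φ i x = 0 := by
  by_contra! hne
  obtain ⟨x, hx, hx0⟩ := Module.Dual.exists_forall_mem_ne_zero_of_forall_exists W φ hne
  exact Finset.prod_ne_zero_iff.2 (fun i _ ↦ hx0 i) (h x hx)

/-- A plane inside a rational 3-space satisfying a nontrivial rational linear equation is
rational. -/
lemma definedOver_of_linear_equation {k K : Type*} [Field k] [Field K] [Algebra k K]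
    {W : Submodule K (Fin 4 → K)} (hW : Module.finrank K W = 2) (u v w : Fin 4 → k) {a b c : k}
    (habc : ¬(a = 0 ∧ b = 0 ∧ c = 0))
    (h : ∀ x ∈ W, ∃ r s t : K,
      x = r • Pi.algebraMap (Fin 4) k K u + s • Pi.algebraMap (Fin 4) k K v +
        t • Pi.algebraMap (Fin 4) k K w ∧
      algebraMap k K a * r + algebraMap k K b * s + algebraMap k K c * t = 0) :
    DefinedOver k W := by
  have hinj (d : k) : algebraMap k K d = 0 ↔ d = 0 := by simp
  by_cases ha : a = 0
  · by_cases hb : b = 0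
    · have hc : algebraMap k K c ≠ 0 := by
        rw [Ne, hinj]
        tauto
      refine definedOver_of_le_span_pair hW (p := u) (q := v) fun x hx ↦ ?_
      obtain ⟨r, s, t, rfl, hrst⟩ := h x hx
      refine Submodule.mem_span_pair.2 ⟨r, s, ?_⟩
      have ht : t = 0 := by simpa [ha, hb, hc] using hrst
      simp [ht]
    · have hb' : algebraMap k K b ≠ 0 := by rwa [Ne, hinj]
      refine definedOver_of_le_span_pair hW (p := u) (q := b • w - c • v) fun x hx ↦ ?_
      obtain ⟨r, s, t, rfl, hrst⟩ := h x hx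
      refine Submodule.mem_span_pair.2 ⟨r, t / algebraMap k K b, ?_⟩
      ext i
      simp only [ha, map_zero, zero_mul, zero_add] at hrst
      simp [Pi.algebraMap]
      field_simp
      linear_combination (-(algebraMap k K (v i))) * hrst
  · have ha' : algebraMap k K a ≠ 0 := by rwa [Ne, hinj]
    refine definedOver_of_le_span_pair hW (p := a • v - b • u) (q := a • w - c • u)
      fun x hx ↦ ?_
    obtain ⟨r, s, t, rfl, hrst⟩ := h x hx
    refine Submodule.mem_span_pair.2 ⟨s / algebraMap k K a, t / algebraMap k K a, ?_⟩
    ext i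
    simp [Pi.algebraMap]
    field_simp
    linear_combination (-(algebraMap k K (u i))) * hrst

/-- If a cubic surface over an algebraically closed field has no singular point and its equation
is defined over `k`, then the residual line of two coplanar lines over `k` is defined over `k`. -/
theorem definedOver_third_line {k K : Type*} [Field k] [Field K] [IsAlgClosed K] [Algebra k K]
    {f : MvPolynomial (Fin 4) k} (hf : f.IsHomogeneous 3)
    (hsm : ∀ x : Fin 4 → K, eval x (map (algebraMap k K) f) = 0 →
      (∀ i, eval x (pderiv i (map (algebraMap k K) f)) = 0) → x = 0)
    {W₁ W₂ W₃ : Submodule K (Fin 4 → K)}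
    (h1 : IsLineOn (map (algebraMap k K) f) W₁) (h2 : IsLineOn (map (algebraMap k K) f) W₂)
    (h3 : IsLineOn (map (algebraMap k K) f) W₃)
    (hne12 : W₁ ≠ W₂) (hne13 : W₁ ≠ W₃) (hne23 : W₂ ≠ W₃)
    {H : Submodule K (Fin 4 → K)} (hH : Module.finrank K H = 3)
    (hH1 : W₁ ≤ H) (hH2 : W₂ ≤ H) (hH3 : W₃ ≤ H)
    (hd1 : DefinedOver k W₁) (hd2 : DefinedOver k W₂) :
    DefinedOver k W₃ := by
  set F := map (algebraMap k K) f with hF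
  obtain ⟨A, hA⟩ := hd1
  obtain ⟨B, hB⟩ := hd2
  change W₁ = Submodule.span K (Pi.algebraMap (Fin 4) k K '' A) at hA
  change W₂ = Submodule.span K (Pi.algebraMap (Fin 4) k K '' B) at hB
  have hAB : Module.finrank k ↥(A ⊔ B) ≤ 3 := by
    rw [← finrank_span_image_algebraMap (K := K), ← hH]
    refine Submodule.finrank_mono ?_
    rw [← A.span_eq, ← B.span_eq, ← Submodule.span_union, span_image_algebraMap_span,
      Set.image_union, Submodule.span_union, ← hA, ← hB]
    exact sup_le hH1 hH2
  obtain ⟨u, v, w, rfl, rfl, hli⟩ := Submodule.exists_adapted_triple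
    (by rw [← finrank_span_image_algebraMap (K := K), ← hA, h1.1])
    (by rw [← finrank_span_image_algebraMap (K := K), ← hB, h2.1])
    (by rintro rfl; exact hne12 (hA.trans hB.symm)) hAB
  rw [span_image_algebraMap_span, Set.image_pair] at hA hB
  have hliK := linearIndependent_algebraMap_comp_iff (S := K).2 hli
  let T := Fintype.linearCombination K fun j ↦ algebraMap k K ∘ ![u, v, w] j
  have hT (c : Fin 3 → K) : T c = c 0 • Pi.algebraMap (Fin 4) k K u +
      c 1 • Pi.algebraMap (Fin 4) k K v + c 2 • Pi.algebraMap (Fin 4) k K w := by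
    simp [T, Fintype.linearCombination_apply, Fin.sum_univ_three]
    rfl
  have hrange : LinearMap.range T = H := by
    refine Submodule.eq_of_le_of_finrank_le ?_ ?_
    · rintro _ ⟨c, rfl⟩
      have hu : Pi.algebraMap (Fin 4) k K u ∈ W₁ := hA ▸ Submodule.subset_span (by simp)
      have hv : Pi.algebraMap (Fin 4) k K v ∈ W₁ := hA ▸ Submodule.subset_span (by simp)
      have hw : Pi.algebraMap (Fin 4) k K w ∈ W₂ := hB ▸ Submodule.subset_span (by simp)
      rw [hT]
      exact add_mem (add_mem (H.smul_mem _ (hH1 hu)) (H.smul_mem _ (hH1 hv)))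
        (H.smul_mem _ (hH2 hw))
    · rw [hH, Fintype.range_linearCombination, finrank_span_eq_card hliK, Fintype.card_fin]
  obtain ⟨g, hg⟩ := LinearMap.exists_leftInverse_of_injective T
    (LinearMap.ker_eq_bot.2 hliK.fintypeLinearCombination_injective)
  have hTg {x : Fin 4 → K} (hx : x ∈ H) : T (g x) = x := by
    obtain ⟨c, rfl⟩ := hrange ▸ hx
    exact congrArg T (LinearMap.congr_fun hg c)
  let G : MvPolynomial (Fin 3) k := aeval (fun i ↦ ∑ j, C (![u, v, w] j i) * X j) f
  have hG : G.IsHomogeneous 3 := hf.aeval _ fun i ↦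
    IsHomogeneous.sum _ _ _ fun j _ ↦ isHomogeneous_C_mul_X _ _
  have hGF (c : Fin 3 → K) : aeval c G = eval (T c) F := by
    rw [hF, eval_map, ← aeval_def, ← AlgHom.comp_apply]
    congr 1
    ext i
    simp [T, Fintype.linearCombination_apply, Fin.sum_univ_three]
    ring
  obtain ⟨a, b, c, habc⟩ := exists_linear_cofactor (K := K) hG
    (fun x hx ↦ by
      rw [hGF]
      refine h2.eval_eq_zero ?_
      rw [hB, hT]
      exact Submodule.mem_span_pair.2 ⟨x 0, x 2, by simp [hx]⟩)
    (fun x hx ↦ by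
      rw [hGF]
      refine h1.eval_eq_zero ?_
      rw [hA, hT]
      exact Submodule.mem_span_pair.2 ⟨x 0, x 1, by simp [hx]⟩)
  have hFH {x : Fin 4 → K} (hx : x ∈ H) : eval x F = g x 1 * g x 2 *
      (algebraMap k K a * g x 0 + algebraMap k K b * g x 1 + algebraMap k K c * g x 2) := by
    rw [← habc, hGF, hTg hx]
  have hnonzero : ¬(a = 0 ∧ b = 0 ∧ c = 0) := by
    rintro ⟨rfl, rfl, rfl⟩
    have hvanish : ∀ x ∈ H, eval x F = 0 := fun x hx ↦ by simp [hFH hx]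
    have hli2 : LinearIndependent K ![T (Pi.single 0 1), T (Pi.single 1 1)] := by
      have h01 : ![T (Pi.single 0 1), T (Pi.single 1 1)] =
          (fun j ↦ algebraMap k K ∘ ![u, v, w] j) ∘ ![0, 1] := by
        ext j
        fin_cases j <;> simp [T, Fintype.linearCombination_apply_single]
      rw [h01]
      exact hliK.comp ![0, 1] (by decide)
    obtain ⟨x, hx, hx0, hsing⟩ := exists_singular_of_vanishes_on_hyperplane
      (hf.map (algebraMap k K)) (by norm_num) (by simp [hH]) hvanish
      (hrange ▸ LinearMap.mem_range_self T _) (hrange ▸ LinearMap.mem_range_self T _) hli2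
    exact hx0 (hsm x (hvanish x hx) hsing)
  let y (i : Fin 3) : Module.Dual K (Fin 4 → K) := LinearMap.proj i ∘ₗ g
  obtain ⟨i, hi⟩ := W₃.exists_forall_eq_zero_of_prod_eq_zero
    ![algebraMap k K a • y 0 + algebraMap k K b • y 1 + algebraMap k K c • y 2, y 1, y 2]
    (fun x hx ↦ by
      have h := h3.eval_eq_zero hx
      rw [hFH (hH3 hx)] at h
      simp only [Fin.prod_univ_three]
      simp [y, Algebra.smul_def] at h ⊢
      tauto)
  have hW₃ {x : Fin 4 → K} (hx : x ∈ W₃) := (hTg (hH3 hx)).symm.trans (hT _)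
  fin_cases i
  · exact definedOver_of_linear_equation h3.1 u v w hnonzero fun x hx ↦
      ⟨g x 0, g x 1, g x 2, hW₃ hx, hi x hx⟩
  · refine absurd (Submodule.eq_of_le_of_finrank_eq (fun x hx ↦ ?_) (h3.1.trans h2.1.symm)).symm
      hne23
    have hx1 : g x 1 = 0 := hi x hx
    rw [hB, hW₃ hx]
    exact Submodule.mem_span_pair.2 ⟨g x 0, g x 2, by simp [hx1]⟩
  · refine absurd (Submodule.eq_of_le_of_finrank_eq (fun x hx ↦ ?_) (h3.1.trans h1.1.symm)).symm
      hne13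
    have hx2 : g x 2 = 0 := hi x hx
    rw [hA, hW₃ hx]
    exact Submodule.mem_span_pair.2 ⟨g x 0, g x 1, by simp [hx2]⟩

/-- for a smooth cubic surface over a perfect field `k`, if two of three
distinct coplanar lines over the algebraic closure are defined over `k`, so is the third. -/
theorem third_coplanar_line_defined_over_base {k : Type*} [Field k] [PerfectField k]
    (f : MvPolynomial (Fin 4) k) (hf : IsSmoothCubic k f)
    (W₁ W₂ W₃ : Submodule (AlgebraicClosure k) (Fin 4 → AlgebraicClosure k))
    (h1 : IsLineOn (map (algebraMap k (AlgebraicClosure k)) f) W₁)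
    (h2 : IsLineOn (map (algebraMap k (AlgebraicClosure k)) f) W₂)
    (h3 : IsLineOn (map (algebraMap k (AlgebraicClosure k)) f) W₃)
    (hne12 : W₁ ≠ W₂) (hne13 : W₁ ≠ W₃) (hne23 : W₂ ≠ W₃)
    (hcoplanar : ∃ H : Submodule (AlgebraicClosure k) (Fin 4 → AlgebraicClosure k),
      Module.finrank (AlgebraicClosure k) H = 3 ∧ W₁ ≤ H ∧ W₂ ≤ H ∧ W₃ ≤ H)
    (hd1 : DefinedOver k W₁) (hd2 : DefinedOver k W₂) :
    DefinedOver k W₃ := by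
  obtain ⟨H, hH, hH1, hH2, hH3⟩ := hcoplanar
  refine definedOver_third_line hf.2.1 (fun x hx hsing ↦ hf.2.2 x ⟨hx, fun i ↦ ?_⟩) h1 h2 h3
    hne12 hne13 hne23 hH hH1 hH2 hH3 hd1 hd2
  rw [← pderiv_map]
  exact hsing i
end

section
/- Let k be a perfect field and let f be a nonzero homogeneous polynomial of degree 3 in four variables over k defining a smooth cubic surface V(f). If V(f) contains two distinct lines W₁, W₂ defined over k with W₁ ∩ W₂ ≠ {0}, then V(f) contains a third line W₃ defined over k, distinct from W₁ and W₂, with W₃ ∩ W₁ ≠ {0} and W₃ ∩ W₂ ≠ {0}. -/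
open MvPolynomial

section LinearSubstitution

variable {k : Type*} [Field k]

/-- The pullback of `f` along the linear map sending the `j`-th coordinate vector to `b j`. -/
noncomputable def linearSubst (b : Fin 4 → Fin 4 → k) (f : MvPolynomial (Fin 4) k) :
    MvPolynomial (Fin 4) k :=
  aeval (fun i => ∑ j, C (b j i) * X j) f

theorem pderiv_aeval_eq_sum {R σ τ : Type*} [CommRing R] [Fintype σ] (φ : σ → MvPolynomial τ R)
    (f : MvPolynomial σ R) (j : τ) :
    pderiv j (aeval φ f) = ∑ i, aeval φ (pderiv i f) * pderiv j (φ i) := by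
  classical
  induction f using MvPolynomial.induction_on with
  | C a => simp [algebraMap_eq]
  | add p q hp hq => simp only [map_add, hp, hq, add_mul, Finset.sum_add_distrib]
  | mul_X p n hp =>
    simp only [map_mul, aeval_X, Derivation.leibniz, hp, smul_eq_mul, pderiv_X, map_add, add_mul,
      Finset.sum_add_distrib, Finset.mul_sum]
    congr 1
    · rw [Finset.sum_eq_single n]
      · simp
      · intro i _ hi
        simp [Ne.symm hi]
      · simp
    · exact Finset.sum_congr rfl fun i _ => by ring

theorem aeval_linearSubst {A : Type*} [CommRing A] [Algebra k A] (b : Fin 4 → Fin 4 → k)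
    (f : MvPolynomial (Fin 4) k) (y : Fin 4 → A) :
    aeval y (linearSubst b f) = aeval (fun i => ∑ j, algebraMap k A (b j i) * y j) f := by
  rw [linearSubst, ← AlgHom.comp_apply, comp_aeval]
  simp

theorem isHomogeneous_linearSubst {f : MvPolynomial (Fin 4) k} {n : ℕ} (hf : f.IsHomogeneous n)
    (b : Fin 4 → Fin 4 → k) : (linearSubst b f).IsHomogeneous n := by
  simpa only [one_mul, linearSubst] using hf.aeval _ (n := 1) fun i =>
    IsHomogeneous.sum _ _ _ fun j _ => isHomogeneous_C_mul_X (b j i) j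

theorem lineRestrict_linearSubst (b : Fin 4 → Fin 4 → k) (f : MvPolynomial (Fin 4) k)
    (v w : Fin 4 → k) :
    lineRestrict (linearSubst b f) v w = lineRestrict f (∑ j, v j • b j) (∑ j, w j • b j) := by
  rw [lineRestrict, aeval_linearSubst, lineRestrict]
  congr 2
  funext i
  simp only [algebraMap_eq, Finset.sum_apply, Pi.smul_apply, smul_eq_mul, map_sum, map_mul,
    Finset.sum_mul, ← Finset.sum_add_distrib]
  exact Finset.sum_congr rfl fun j _ => by ring

theorem aeval_lineRestrict {A : Type*} [CommRing A] [Algebra k A] (f : MvPolynomial (Fin 4) k)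
    (v w : Fin 4 → k) (y : Fin 2 → A) :
    aeval y (lineRestrict f v w) =
      aeval (fun i => algebraMap k A (v i) * y 0 + algebraMap k A (w i) * y 1) f := by
  rw [lineRestrict, ← AlgHom.comp_apply, comp_aeval]
  simp

/-- Vanishing on a line does not depend on the choice of spanning vectors. -/
theorem lineRestrict_eq_zero_of_mem_span {f : MvPolynomial (Fin 4) k} {v w v' w' : Fin 4 → k}
    (h : lineRestrict f v w = 0) (hv : v' ∈ Submodule.span k {v, w})
    (hw : w' ∈ Submodule.span k {v, w}) : lineRestrict f v' w' = 0 := by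
  obtain ⟨a, b, hv⟩ := Submodule.mem_span_pair.1 hv
  obtain ⟨c, d, hw⟩ := Submodule.mem_span_pair.1 hw
  let y : Fin 2 → MvPolynomial (Fin 2) k := ![C a * X 0 + C c * X 1, C b * X 0 + C d * X 1]
  have hy : lineRestrict f v' w' = aeval y (lineRestrict f v w) := by
    rw [aeval_lineRestrict, lineRestrict]
    congr 2
    funext i
    simp only [← hv, ← hw, Pi.add_apply, Pi.smul_apply, smul_eq_mul, map_add, map_mul,
      algebraMap_eq, y, Matrix.cons_val_zero, Matrix.cons_val_one]
    ring
  rw [hy, h, map_zero]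

/-- Smoothness, phrased through `aeval` as a condition on the points of the affine cone. -/
def IsConeSmooth (K : Type*) [Field K] [Algebra k K] (f : MvPolynomial (Fin 4) k) : Prop :=
  ∀ x : Fin 4 → K, aeval x f = 0 → (∀ i, aeval x (pderiv i f) = 0) → x = 0

theorem IsConeSmooth.linearSubst {K : Type*} [Field K] [Algebra k K] {f : MvPolynomial (Fin 4) k}
    (hf : IsConeSmooth K f) {b : Fin 4 → Fin 4 → k} (hb : LinearIndependent k b) :
    IsConeSmooth K (linearSubst b f) := by
  intro y hy hdy
  have hu : IsUnit (Matrix.of b) := Matrix.linearIndependent_rows_iff_isUnit.1 hb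
  have hu' : IsUnit ((Matrix.of b).map (algebraMap k K)) :=
    hu.map (algebraMap k K).mapMatrix
  have hx : (fun i => ∑ j, algebraMap k K (b j i) * y j) = 0 := by
    refine hf _ (by rw [← aeval_linearSubst, hy]) ?_
    suffices h : ((Matrix.of b).map (algebraMap k K)).mulVec (fun i =>
        aeval (fun i => ∑ j, algebraMap k K (b j i) * y j) (pderiv i f)) = (0 : Fin 4 → K) by
      have := Matrix.mulVec_injective_of_isUnit hu' (a₂ := 0)
        (by rw [h, Matrix.mulVec_zero])
      exact congrFun this
    funext j
    rw [Pi.zero_apply, ← hdy j, _root_.linearSubst, pderiv_aeval_eq_sum, map_sum, Matrix.mulVec,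
      dotProduct]
    refine Finset.sum_congr rfl fun i _ => ?_
    have h1 := aeval_linearSubst b (pderiv i f) y
    rw [_root_.linearSubst] at h1
    rw [map_mul, h1, mul_comm]
    simp [pderiv_X, Pi.single_apply]
  have : ((Matrix.of b).map (algebraMap k K)).vecMul y = 0 := by
    rw [← hx]
    funext i
    simp [Matrix.vecMul, dotProduct, mul_comm]
  exact Matrix.vecMul_injective_of_isUnit hu' (this.trans (Matrix.zero_vecMul _).symm)

end LinearSubstitution

section CubicForms

variable {k : Type*} [Field k]

theorem X_dvd_iff_aeval_update_eq_zero {σ : Type*} [DecidableEq σ] {i : σ} {p : MvPolynomial σ k} :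
    X i ∣ p ↔ aeval (Function.update X i 0 : σ → MvPolynomial σ k) p = 0 := by
  constructor
  · rintro ⟨q, rfl⟩
    simp
  · intro h
    suffices X i ∣ p - aeval (Function.update X i 0 : σ → MvPolynomial σ k) p by
      rwa [h, sub_zero] at this
    clear h
    induction p using MvPolynomial.induction_on with
    | C a => simp [algebraMap_eq]
    | add p q hp hq =>
      rw [map_add, add_sub_add_comm]
      exact dvd_add hp hq
    | mul_X p n hp =>
      rw [map_mul, aeval_X]
      rcases eq_or_ne n i with rfl | hn
      · simp
      · rw [Function.update_of_ne hn, ← sub_mul]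
        exact hp.mul_right _

theorem isHomogeneous_of_X_mul {σ : Type*} {i : σ} {p : MvPolynomial σ k} {n : ℕ}
    (h : (X i * p).IsHomogeneous (n + 1)) : p.IsHomogeneous n := by
  intro d hd
  have := @h (Finsupp.single i 1 + d) (by rwa [coeff_X_mul])
  rw [map_add] at this
  simp only [Finsupp.weight_single, Pi.one_apply, smul_eq_mul, mul_one] at this
  omega

theorem exists_eq_of_isHomogeneous_two {q : MvPolynomial (Fin 2) k} (hq : q.IsHomogeneous 2) :
    ∃ α β γ : k, q = C α * X 0 ^ 2 + C β * (X 0 * X 1) + C γ * X 1 ^ 2 := by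
  rw [q.as_sum]
  refine Finset.sum_induction _ (fun p => ∃ α β γ : k,
    p = C α * X 0 ^ 2 + C β * (X 0 * X 1) + C γ * X 1 ^ 2) ?_ ⟨0, 0, 0, by simp⟩ ?_
  · rintro _ _ ⟨α, β, γ, rfl⟩ ⟨α', β', γ', rfl⟩
    exact ⟨α + α', β + β', γ + γ', by simp only [map_add]; ring⟩
  · intro d hd
    have hdeg : d 0 + d 1 = 2 := by
      simpa [Finsupp.weight_apply, Finsupp.sum_fintype] using hq (mem_support_iff.1 hd)
    have hmon : monomial d (coeff d q) = C (coeff d q) * (X 0 ^ d 0 * X 1 ^ d 1) := by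
      rw [monomial_eq, Finsupp.prod_fintype _ _ (by simp), Fin.prod_univ_two]
    rw [hmon]
    obtain h | h | h : d 0 = 0 ∨ d 0 = 1 ∨ d 0 = 2 := by omega
    · exact ⟨0, 0, coeff d q, by rw [h, show d 1 = 2 by omega]; simp⟩
    · exact ⟨0, coeff d q, 0, by rw [h, show d 1 = 1 by omega]; simp⟩
    · exact ⟨coeff d q, 0, 0, by rw [h, show d 1 = 0 by omega]; simp⟩

theorem exists_root_of_isHomogeneous_two (K : Type*) [Field K] [IsAlgClosed K] [Algebra k K]
    {Q : MvPolynomial (Fin 4) k} (hQ : Q.IsHomogeneous 2) (u v : Fin 4 → k) :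
    ∃ a b : K, (a ≠ 0 ∨ b ≠ 0) ∧
      aeval (fun i => algebraMap k K (u i) * a + algebraMap k K (v i) * b) Q = 0 := by
  have hq : (lineRestrict Q u v).IsHomogeneous 2 := by
    simpa only [one_mul, lineRestrict] using hQ.aeval _ (n := 1) fun i =>
      (isHomogeneous_C_mul_X (u i) (0 : Fin 2)).add (isHomogeneous_C_mul_X (v i) 1)
  obtain ⟨α, β, γ, hαβγ⟩ := exists_eq_of_isHomogeneous_two hq
  suffices ∃ a b : K, (a ≠ 0 ∨ b ≠ 0) ∧ algebraMap k K α * a ^ 2 + algebraMap k K β * (a * b) +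
      algebraMap k K γ * b ^ 2 = 0 by
    obtain ⟨a, b, hab, h⟩ := this
    refine ⟨a, b, hab, ?_⟩
    have := aeval_lineRestrict Q u v ![a, b]
    simp only [Matrix.cons_val_zero, Matrix.cons_val_one] at this
    rw [← this, hαβγ]
    simpa using h
  by_cases hα : α = 0
  · exact ⟨1, 0, by simp [hα]⟩
  · have hα' : algebraMap k K α ≠ 0 := by simpa using hα
    obtain ⟨x, hx⟩ := IsAlgClosed.exists_root (Polynomial.C (algebraMap k K α) * Polynomial.X ^ 2 +
      Polynomial.C (algebraMap k K β) * Polynomial.X + Polynomial.C (algebraMap k K γ))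
      (by rw [Polynomial.degree_quadratic hα']; decide)
    refine ⟨x, 1, by simp, ?_⟩
    simpa [Polynomial.IsRoot] using hx

/-- A cubic form containing the lines `x₂ = x₃ = 0` and `x₁ = x₃ = 0` restricts on the plane
`x₃ = 0` to the product of `x₁ x₂` and a linear form. -/
theorem exists_plane_section_factorization {g : MvPolynomial (Fin 4) k} (hg : g.IsHomogeneous 3)
    (h1 : lineRestrict g (Pi.single 0 1) (Pi.single 1 1) = 0)
    (h2 : lineRestrict g (Pi.single 0 1) (Pi.single 2 1) = 0) :
    ∃ (Q : MvPolynomial (Fin 4) k) (c : Fin 3 → k), Q.IsHomogeneous 2 ∧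
      g = X 3 * Q + X 1 * X 2 * (C (c 0) * X 0 + C (c 1) * X 1 + C (c 2) * X 2) := by
  set h := aeval (Function.update X 3 0 : Fin 4 → MvPolynomial (Fin 4) k) g with hh
  have hhom : h.IsHomogeneous 3 := by
    simpa using hg.aeval _ (n := 1) fun i => by
      rcases eq_or_ne i 3 with rfl | hi
      · simpa using isHomogeneous_zero (Fin 4) k 1
      · simpa [Function.update_of_ne hi] using isHomogeneous_X k i
  have hsub : aeval (Function.update X 3 0 : Fin 4 → MvPolynomial (Fin 4) k) h = h := by
    rw [hh, ← AlgHom.comp_apply, comp_aeval]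
    congr 2
    funext i
    fin_cases i <;> simp
  have hX2 : X 2 ∣ h := by
    rw [X_dvd_iff_aeval_update_eq_zero]
    have := aeval_lineRestrict g (Pi.single 0 1) (Pi.single 1 1)
      ![(X 0 : MvPolynomial (Fin 4) k), X 1]
    rw [h1, map_zero] at this
    rw [hh, ← AlgHom.comp_apply, comp_aeval]
    refine Eq.trans ?_ this.symm
    congr 2
    funext i
    fin_cases i <;> simp
  have hX1 : X 1 ∣ h := by
    rw [X_dvd_iff_aeval_update_eq_zero]
    have := aeval_lineRestrict g (Pi.single 0 1) (Pi.single 2 1)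
      ![(X 0 : MvPolynomial (Fin 4) k), X 2]
    rw [h2, map_zero] at this
    rw [hh, ← AlgHom.comp_apply, comp_aeval]
    refine Eq.trans ?_ this.symm
    congr 2
    funext i
    fin_cases i <;> simp
  obtain ⟨p, hp⟩ := hX2
  rw [hp, X_dvd_mul_iff] at hX1
  obtain ⟨L, hL⟩ := hX1.resolve_left (by rw [X_dvd_X]; decide)
  have hLhom : L.IsHomogeneous 1 := by
    apply isHomogeneous_of_X_mul (i := 1)
    apply isHomogeneous_of_X_mul (i := 2)
    rwa [← hL, ← hp]
  rw [← mem_homogeneousSubmodule, homogeneousSubmodule_one_eq_span_X,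
    Submodule.mem_span_range_iff_exists_fun] at hLhom
  obtain ⟨c, rfl⟩ := hLhom
  have hform : h = X 1 * X 2 * (C (c 0) * X 0 + C (c 1) * X 1 + C (c 2) * X 2) := by
    rw [← hsub, hp, hL]
    simp [Fin.sum_univ_four, smul_eq_C_mul]
    ring
  have hX3 : X 3 ∣ g - h := by
    rw [X_dvd_iff_aeval_update_eq_zero, map_sub, hsub, ← hh, sub_self]
  obtain ⟨Q, hQ⟩ := hX3
  refine ⟨Q, ![c 0, c 1, c 2], isHomogeneous_of_X_mul (i := 3) (hQ ▸ hg.sub hhom), ?_⟩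
  simp only [Matrix.cons_val]
  rw [← hform, ← hQ, sub_add_cancel]

/-- On a smooth cubic the residual line of a plane section containing `x₁ = 0` and `x₂ = 0` is
neither of these two lines. -/
theorem IsConeSmooth.residual_ne {K : Type*} [Field K] [IsAlgClosed K] [Algebra k K]
    {Q : MvPolynomial (Fin 4) k} {c : Fin 3 → k} (hQ : Q.IsHomogeneous 2)
    (hg : IsConeSmooth K
      (X 3 * Q + X 1 * X 2 * (C (c 0) * X 0 + C (c 1) * X 1 + C (c 2) * X 2))) :
    (c 0 ≠ 0 ∨ c 2 ≠ 0) ∧ (c 0 ≠ 0 ∨ c 1 ≠ 0) := by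
  constructor <;> by_contra! hc
  · obtain ⟨a, b, hab, h⟩ := exists_root_of_isHomogeneous_two K hQ (Pi.single 0 1) (Pi.single 2 1)
    set x : Fin 4 → K := fun i => algebraMap k K ((Pi.single 0 1 : Fin 4 → k) i) * a +
      algebraMap k K ((Pi.single 2 1 : Fin 4 → k) i) * b with hx
    have hx0 : x 0 = a := by simp [hx]
    have hx2 : x 2 = b := by simp [hx]
    have hx1 : x 1 = 0 := by simp [hx]
    have hx3 : x 3 = 0 := by simp [hx]
    have : x = 0 := hg x (by simp [hx1, hx3]) fun i => by
      fin_cases i <;> simp [hc, h, hx1, hx3, pderiv_X]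
    have ha : a = 0 := by rw [← hx0, this, Pi.zero_apply]
    have hb : b = 0 := by rw [← hx2, this, Pi.zero_apply]
    exact hab.elim (· ha) (· hb)
  · obtain ⟨a, b, hab, h⟩ := exists_root_of_isHomogeneous_two K hQ (Pi.single 0 1) (Pi.single 1 1)
    set x : Fin 4 → K := fun i => algebraMap k K ((Pi.single 0 1 : Fin 4 → k) i) * a +
      algebraMap k K ((Pi.single 1 1 : Fin 4 → k) i) * b with hx
    have hx0 : x 0 = a := by simp [hx]
    have hx1 : x 1 = b := by simp [hx]
    have hx2 : x 2 = 0 := by simp [hx]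
    have hx3 : x 3 = 0 := by simp [hx]
    have : x = 0 := hg x (by simp [hx2, hx3]) fun i => by
      fin_cases i <;> simp [hc, h, hx2, hx3, pderiv_X]
    have ha : a = 0 := by rw [← hx0, this, Pi.zero_apply]
    have hb : b = 0 := by rw [← hx1, this, Pi.zero_apply]
    exact hab.elim (· ha) (· hb)

theorem lineRestrict_residual_eq_zero {Q : MvPolynomial (Fin 4) k} {c : Fin 3 → k}
    {v w : Fin 4 → k} (hv3 : v 3 = 0) (hw3 : w 3 = 0)
    (hv : c 0 * v 0 + c 1 * v 1 + c 2 * v 2 = 0) (hw : c 0 * w 0 + c 1 * w 1 + c 2 * w 2 = 0) :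
    lineRestrict (X 3 * Q + X 1 * X 2 * (C (c 0) * X 0 + C (c 1) * X 1 + C (c 2) * X 2)) v w
      = 0 := by
  have hL : C (c 0) * (C (v 0) * X 0 + C (w 0) * X 1) + C (c 1) * (C (v 1) * X 0 + C (w 1) * X 1) +
      C (c 2) * (C (v 2) * X 0 + C (w 2) * X 1) = (0 : MvPolynomial (Fin 2) k) := by
    have hv' := congrArg (C (σ := Fin 2)) hv
    have hw' := congrArg (C (σ := Fin 2)) hw
    simp only [map_add, map_mul, map_zero] at hv' hw'
    linear_combination X 0 * hv' + X 1 * hw'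
  simp [lineRestrict, hv3, hw3, algebraMap_eq, hL]

end CubicForms

section Lines

variable {k V : Type*} [Field k] [AddCommGroup V] [Module k V]

theorem finrank_span_pair_eq_two {v w : V} (hv : v ≠ 0) (hw : w ∉ Submodule.span k {v}) :
    Module.finrank k (Submodule.span k {v, w}) = 2 := by
  have hli : LinearIndependent k ![v, w] :=
    (LinearIndependent.pair_iff' hv).2 fun a ha => hw (Submodule.mem_span_singleton.2 ⟨a, ha⟩)
  rw [← Matrix.range_cons_cons_empty v w ![], finrank_span_eq_card hli, Fintype.card_fin]

theorem span_pair_eq_of_finrank_eq_two {W : Submodule k V} (hW : Module.finrank k W = 2) {v w : V}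
    (hv : v ∈ W) (hw : w ∈ W) (hv0 : v ≠ 0) (hvw : w ∉ Submodule.span k {v}) :
    Submodule.span k {v, w} = W := by
  have : FiniteDimensional k W := Module.finite_of_finrank_pos (by omega)
  exact Submodule.eq_of_le_of_finrank_eq (Submodule.span_le.2 (by simp [Set.insert_subset_iff, *]))
    (by rw [finrank_span_pair_eq_two hv0 hvw, hW])

theorem sub_smul_notMem {W : Submodule k V} {x y : V} {a c : k} (hx : x ∈ W) (hy : y ∉ W)
    (hc : c ≠ 0) : a • x - c • y ∉ W := fun h =>
  hy <| (W.smul_mem_iff hc).1 <| by simpa using W.sub_mem (W.smul_mem a hx) h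

theorem IsLineOn.lineRestrict_eq_zero {f : MvPolynomial (Fin 4) k}
    {W : Submodule k (Fin 4 → k)} (h : IsLineOn f W) {v w : Fin 4 → k} (hv : v ∈ W) (hw : w ∈ W) :
    lineRestrict f v w = 0 := by
  obtain ⟨-, v', w', rfl, h⟩ := h
  exact lineRestrict_eq_zero_of_mem_span h hv hw

theorem IsSmoothCubic.isConeSmooth {f : MvPolynomial (Fin 4) k} (hf : IsSmoothCubic k f) :
    IsConeSmooth (AlgebraicClosure k) f := fun x h0 h1 =>
  hf.2.2 x ⟨by rwa [eval_map, ← aeval_def], fun i => by rw [eval_map, ← aeval_def, h1]⟩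

/-- The plane spanned by two incident lines `⟨e₀, e₁⟩` and `⟨e₀, e₂⟩` of a smooth cubic surface
meets the surface residually in a line `c₀ x₀ + c₁ x₁ + c₂ x₂ = 0` different from both. -/
theorem exists_residual_line {f : MvPolynomial (Fin 4) k} (hf : IsSmoothCubic k f)
    {b : Fin 4 → Fin 4 → k} (hb : LinearIndependent k b) (h1 : lineRestrict f (b 0) (b 1) = 0)
    (h2 : lineRestrict f (b 0) (b 2) = 0) :
    ∃ c : Fin 3 → k, (c 0 ≠ 0 ∨ c 2 ≠ 0) ∧ (c 0 ≠ 0 ∨ c 1 ≠ 0) ∧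
      ∀ v w : Fin 3 → k, ∑ i, c i * v i = 0 → ∑ i, c i * w i = 0 →
        lineRestrict f (v 0 • b 0 + v 1 • b 1 + v 2 • b 2)
          (w 0 • b 0 + w 1 • b 1 + w 2 • b 2) = 0 := by
  obtain ⟨Q, c, hQ, hg⟩ := exists_plane_section_factorization
    (isHomogeneous_linearSubst hf.2.1 b)
    (by rw [lineRestrict_linearSubst]; simpa [Fin.sum_univ_four] using h1)
    (by rw [lineRestrict_linearSubst]; simpa [Fin.sum_univ_four] using h2)
  have hs := hf.isConeSmooth.linearSubst hb
  rw [hg] at hs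
  obtain ⟨hc2, hc1⟩ := hs.residual_ne hQ
  refine ⟨c, hc2, hc1, fun v w hv hw => ?_⟩
  have := lineRestrict_linearSubst b f ![v 0, v 1, v 2, 0] ![w 0, w 1, w 2, 0]
  rw [hg, lineRestrict_residual_eq_zero (by simp) (by simp)
    (by simpa [Fin.sum_univ_three] using hv) (by simpa [Fin.sum_univ_three] using hw)] at this
  simpa [Fin.sum_univ_four] using this.symm

end Lines

/-- two intersecting `k`-lines on a smooth cubic surface over a perfect
field yield a third `k`-line meeting both. -/
theorem exists_third_line_meeting_two {k : Type*} [Field k] [PerfectField k]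
    (f : MvPolynomial (Fin 4) k) (hf : IsSmoothCubic k f)
    (W₁ W₂ : Submodule k (Fin 4 → k))
    (h1 : IsLineOn f W₁) (h2 : IsLineOn f W₂) (hne : W₁ ≠ W₂)
    (hint : W₁ ⊓ W₂ ≠ ⊥) :
    ∃ W₃ : Submodule k (Fin 4 → k), IsLineOn f W₃ ∧ W₃ ≠ W₁ ∧ W₃ ≠ W₂ ∧
      W₃ ⊓ W₁ ≠ ⊥ ∧ W₃ ⊓ W₂ ≠ ⊥ := by
  obtain ⟨e₀, ⟨he₁, he₂⟩, he⟩ := Submodule.exists_mem_ne_zero_of_ne_bot hint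
  have hle : ∀ {U W : Submodule k (Fin 4 → k)}, IsLineOn f U → IsLineOn f W → U ≠ W →
      ∃ e ∈ U, e ∉ W := fun hU hW hUW => SetLike.not_le_iff_exists.1 fun h =>
    hUW (Submodule.eq_of_le_of_finrank_eq h (hU.1.trans hW.1.symm))
  obtain ⟨e₁, h₁₁, h₁₂⟩ := hle h1 h2 hne
  obtain ⟨e₂, h₂₂, h₂₁⟩ := hle h2 h1 hne.symm
  have hspan : Submodule.span k {e₀, e₁} = W₁ :=
    span_pair_eq_of_finrank_eq_two h1.1 he₁ h₁₁ he fun h =>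
      h₁₂ ((Submodule.span_singleton_le_iff_mem _ _).2 he₂ h)
  obtain ⟨e₃, he₃⟩ : ∃ e₃, e₃ ∉ Submodule.span k (Set.range ![e₂, e₁, e₀]) := by
    by_contra! h
    have := finrank_range_le_card (R := k) ![e₂, e₁, e₀]
    rw [Set.finrank, Submodule.eq_top_iff'.2 h, finrank_top, Module.finrank_fin_fun,
      Fintype.card_fin] at this
    omega
  have hb : LinearIndependent k ![e₀, e₁, e₂, e₃] := by
    have : LinearIndependent k ![e₃, e₂, e₁, e₀] := by
      refine linearIndependent_finCons.2 ⟨linearIndependent_finCons.2 ⟨?_, ?_⟩, he₃⟩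
      · rw [LinearIndependent.pair_symm_iff, LinearIndependent.pair_iff' he]
        rintro a rfl
        exact h₁₂ (W₂.smul_mem a he₂)
      · rwa [Matrix.range_cons_cons_empty, Set.pair_comm, hspan]
    convert this.comp Fin.rev Fin.rev_injective using 1
    funext i
    fin_cases i <;> rfl
  obtain ⟨c, hc2, hc1, hc⟩ := exists_residual_line hf hb (h1.lineRestrict_eq_zero he₁ h₁₁)
    (h2.lineRestrict_eq_zero he₂ h₂₂)
  suffices ∃ v w, lineRestrict f v w = 0 ∧ v ∈ W₁ ∧ v ≠ 0 ∧ w ∉ W₁ ∧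
      (∃ x ∈ Submodule.span k {v, w}, x ∉ W₂) ∧ ∃ y ∈ Submodule.span k {v, w}, y ∈ W₂ ∧ y ≠ 0 by
    obtain ⟨v, w, h, hv, hv0, hw, ⟨x, hx, hx2⟩, y, hy, hy2, hy0⟩ := this
    have hvs : v ∈ Submodule.span k {v, w} := Submodule.subset_span (by simp)
    have hws : w ∈ Submodule.span k {v, w} := Submodule.subset_span (by simp)
    refine ⟨Submodule.span k {v, w}, ⟨finrank_span_pair_eq_two hv0 fun h =>
      hw ((Submodule.span_singleton_le_iff_mem _ _).2 hv h), v, w, rfl, h⟩,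
      fun h => hw (h ▸ hws), fun h => hx2 (h ▸ hx), ?_, ?_⟩
    · exact (Submodule.ne_bot_iff _).2 ⟨v, ⟨hvs, hv⟩, hv0⟩
    · exact (Submodule.ne_bot_iff _).2 ⟨y, ⟨hy, hy2⟩, hy0⟩
  by_cases hc0 : c 0 = 0
  · replace hc1 := hc1.resolve_left (not_not.2 hc0)
    replace hc2 := hc2.resolve_left (not_not.2 hc0)
    refine ⟨e₀, c 2 • e₁ - c 1 • e₂, ?_, he₁, he, sub_smul_notMem h₁₁ h₂₁ hc1,
      ⟨c 2 • e₁ - c 1 • e₂, Submodule.subset_span (by simp), ?_⟩, e₀, Submodule.subset_span (by simp), he₂, he⟩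
    · simpa [sub_eq_add_neg] using hc ![1, 0, 0] ![0, c 2, -c 1] (by simp [Fin.sum_univ_three, hc0])
        (by simp [Fin.sum_univ_three]; ring)
    · rw [← neg_mem_iff, neg_sub]
      exact sub_smul_notMem h₂₂ h₁₂ hc2
  · have hv : c 1 • e₀ - c 0 • e₁ ∉ W₂ := sub_smul_notMem he₂ h₁₂ hc0
    have hw : c 2 • e₀ - c 0 • e₂ ∉ W₁ := sub_smul_notMem he₁ h₂₁ hc0
    refine ⟨_, _, ?_, W₁.sub_mem (W₁.smul_mem (c 1) he₁) (W₁.smul_mem (c 0) h₁₁),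
      fun h => hv (h ▸ W₂.zero_mem), hw, ⟨_, Submodule.subset_span (by simp), hv⟩,
      _, Submodule.subset_span (Set.mem_insert_of_mem _ rfl),
      W₂.sub_mem (W₂.smul_mem (c 2) he₂) (W₂.smul_mem (c 0) h₂₂), fun h => hw (h ▸ W₁.zero_mem)⟩
    simpa [sub_eq_add_neg] using hc ![c 1, -c 0, 0] ![c 2, 0, -c 0]
      (by simp [Fin.sum_univ_three]; ring) (by simp [Fin.sum_univ_three]; ring)
end

section
/- Let k be a field and let f be a nonzero homogeneous polynomial of degree 3 in four variables over k defining a smooth cubic surface V(f). Suppose W₁, W₂, W₃ are three distinct pairwise-intersecting lines on V(f) defined over k. Then every line on V(f) defined over k other than W₁, W₂, W₃ intersects at least one of W₁, W₂, W₃. -/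
open MvPolynomial

namespace CubicSurface

/-- The derivative in direction `y` at `x` of the cubic form `x ↦ T x x x`. -/
def polar {K M : Type*} [CommRing K] [AddCommGroup M] [Module K M]
    (T : M →ₗ[K] M →ₗ[K] M →ₗ[K] K) (x y : M) : K :=
  T y x x + T x y x + T x x y

/-- The full polarization of the cubic form `x ↦ T x x x`. -/
def polar₃ {K M : Type*} [CommRing K] [AddCommGroup M] [Module K M]
    (T : M →ₗ[K] M →ₗ[K] M →ₗ[K] K) (x y z : M) : K :=
  T x y z + T x z y + T y x z + T y z x + T z x y + T z y x

section Polarization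

variable {K M : Type*} [CommRing K] [AddCommGroup M] [Module K M]
  (T : M →ₗ[K] M →ₗ[K] M →ₗ[K] K)

theorem cubic_smul_add_smul (s t : K) (x y : M) :
    T (s • x + t • y) (s • x + t • y) (s • x + t • y) =
      s ^ 3 * T x x x + s ^ 2 * t * polar T x y + s * t ^ 2 * polar T y x + t ^ 3 * T y y y := by
  simp only [polar, map_add, map_smul, LinearMap.add_apply, LinearMap.smul_apply, smul_eq_mul]
  ring

theorem cubic_smul_add_smul_add_smul (r s t : K) (x y z : M) :
    T (r • x + s • y + t • z) (r • x + s • y + t • z) (r • x + s • y + t • z) =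
      r ^ 3 * T x x x + s ^ 3 * T y y y + t ^ 3 * T z z z +
      r ^ 2 * s * polar T x y + r * s ^ 2 * polar T y x +
      r ^ 2 * t * polar T x z + r * t ^ 2 * polar T z x +
      s ^ 2 * t * polar T y z + s * t ^ 2 * polar T z y + r * s * t * polar₃ T x y z := by
  simp only [polar, polar₃, map_add, map_smul, LinearMap.add_apply, LinearMap.smul_apply,
    smul_eq_mul]
  ring

theorem polar_smul_add_smul_left (s t : K) (x y z : M) :
    polar T (s • x + t • y) z =
      s ^ 2 * polar T x z + s * t * polar₃ T x y z + t ^ 2 * polar T y z := by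
  simp only [polar, polar₃, map_add, map_smul, LinearMap.add_apply, LinearMap.smul_apply,
    smul_eq_mul]
  ring

theorem polar_add_right (x y z : M) : polar T x (y + z) = polar T x y + polar T x z := by
  simp only [polar, map_add, LinearMap.add_apply]
  ring

theorem polar_smul_right (c : K) (x y : M) : polar T x (c • y) = c * polar T x y := by
  simp only [polar, map_smul, LinearMap.smul_apply, smul_eq_mul]
  ring

theorem polar_self (x : M) : polar T x x = 3 * T x x x := by
  simp only [polar]
  ring

theorem polar₃_self_left (x y : M) : polar₃ T x y x = 2 * polar T x y := by
  simp only [polar, polar₃]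
  ring

theorem polar₃_self_right (x y : M) : polar₃ T x y y = 2 * polar T y x := by
  simp only [polar, polar₃]
  ring

end Polarization

theorem exists_trilinear_of_isHomogeneous {K σ : Type*} [Field K] [Fintype σ]
    {f : MvPolynomial σ K} (hf : f.IsHomogeneous 3) :
    ∃ T : (σ → K) →ₗ[K] (σ → K) →ₗ[K] (σ → K) →ₗ[K] K,
      (∀ x, eval x f = T x x x) ∧
        ∀ x y, ∑ i, y i * eval x (pderiv i f) = polar T x y := by
  classical
  have monomial_case : ∀ d ∈ f.support, ∃ T : (σ → K) →ₗ[K] (σ → K) →ₗ[K] (σ → K) →ₗ[K] K,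
      (∀ x, eval x (monomial d (coeff d f)) = T x x x) ∧
        ∀ x y, ∑ i, y i * eval x (pderiv i (monomial d (coeff d f))) = polar T x y := by
    intro d hd
    have hdeg : Multiset.card (Finsupp.toMultiset d) = 3 := by
      rw [Finsupp.card_toMultiset]
      exact (DFunLike.congr_fun Finsupp.degree_eq_weight_one d).trans (hf (mem_support_iff.mp hd))
    obtain ⟨i, j, l, hijl⟩ := Multiset.card_eq_three.mp hdeg
    have hd' : d = Finsupp.single i 1 + Finsupp.single j 1 + Finsupp.single l 1 := by
      rw [← Finsupp.toMultiset_toFinsupp d, hijl]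
      ext m
      simp [Finsupp.single_apply, Multiset.count_singleton, Multiset.count_cons, eq_comm]
      ring
    have hmon : monomial d (coeff d f) = C (coeff d f) * (X i * X j * X l) := by
      generalize coeff d f = c
      rw [hd']
      simp [X, C_mul_monomial, monomial_mul]
    refine ⟨coeff d f • (LinearMap.proj i).smulRight
      ((LinearMap.proj j).smulRight (LinearMap.proj l)), fun x => ?_, fun x y => ?_⟩
    · rw [hmon]
      simp [mul_assoc]
    · have hder : ∀ m, eval x (pderiv m (X i * X j * X l : MvPolynomial σ K)) =
          Pi.single (M := fun _ => K) i 1 m * (x j * x l) +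
            Pi.single (M := fun _ => K) j 1 m * (x i * x l) +
              Pi.single (M := fun _ => K) l 1 m * (x i * x j) := by
        intro m
        have hX : ∀ n, eval x (pderiv m (X n)) = Pi.single (M := fun _ => K) n 1 m := by
          intro n
          rw [pderiv_X]
          by_cases h : m = n
          · subst h; simp
          · simp [h]
        simp only [Derivation.leibniz, smul_eq_mul, map_add, map_mul, eval_X, hX]
        ring
      have hsum : ∀ n, ∑ m, y m * Pi.single (M := fun _ => K) n 1 m = y n := by
        intro n
        simp [Pi.single_apply]
      have hterm : ∀ m, y m * eval x (pderiv m (monomial d (coeff d f))) =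
          coeff d f * ((y m * Pi.single (M := fun _ => K) i 1 m) * (x j * x l) +
            (y m * Pi.single (M := fun _ => K) j 1 m) * (x i * x l) +
              (y m * Pi.single (M := fun _ => K) l 1 m) * (x i * x j)) := by
        intro m
        rw [hmon, pderiv_C_mul, map_mul, eval_C, hder]
        ring
      simp only [hterm, ← Finset.mul_sum, Finset.sum_add_distrib, ← Finset.sum_mul, hsum]
      simp [polar]
      ring
  choose! T hT hT' using monomial_case
  refine ⟨∑ d ∈ f.support, T d, fun x => ?_, fun x y => ?_⟩
  · conv_lhs => rw [f.as_sum]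
    rw [map_sum, Finset.sum_congr rfl fun d hd => hT d hd x]
    simp
  · have : polar (∑ d ∈ f.support, T d) x y = ∑ d ∈ f.support, polar (T d) x y := by
      simp [polar, Finset.sum_add_distrib]
    rw [this, ← Finset.sum_congr rfl fun d hd => hT' d hd x y, Finset.sum_comm]
    refine Finset.sum_congr rfl fun i _ => ?_
    conv_lhs => rw [f.as_sum]
    simp only [map_sum, Finset.mul_sum]

theorem exists_ne_zero_quadratic_eq_zero {K : Type*} [Field K] [IsAlgClosed K] (a b c : K) :
    ∃ s t : K, (s ≠ 0 ∨ t ≠ 0) ∧ s ^ 2 * a + s * t * b + t ^ 2 * c = 0 := by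
  by_cases ha : a = 0
  · exact ⟨1, 0, Or.inl one_ne_zero, by simp [ha]⟩
  · obtain ⟨s, hs⟩ := IsAlgClosed.exists_root
      (Polynomial.C a * Polynomial.X ^ 2 + Polynomial.C b * Polynomial.X + Polynomial.C c)
      (by rw [Polynomial.degree_quadratic ha]; decide)
    refine ⟨s, 1, Or.inr one_ne_zero, ?_⟩
    simp only [Polynomial.IsRoot.def, Polynomial.eval_add, Polynomial.eval_mul, Polynomial.eval_C,
      Polynomial.eval_pow, Polynomial.eval_X] at hs
    linear_combination hs

theorem polar_eq_zero_of_forall_smul_add_smul {K M : Type*} [Field K] [Infinite K]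
    [AddCommGroup M] [Module K M] {T : M →ₗ[K] M →ₗ[K] M →ₗ[K] K} {x y : M}
    (h : ∀ s t : K, T (s • x + t • y) (s • x + t • y) (s • x + t • y) = 0) :
    polar T x y = 0 := by
  have hx : T x x x = 0 := by simpa using h 1 0
  have hy : T y y y = 0 := by simpa using h 0 1
  classical
  obtain ⟨a, ha⟩ := Infinite.exists_notMem_finset ({0, 1} : Finset K)
  simp only [Finset.mem_insert, Finset.mem_singleton, not_or] at ha
  have h₁ := h 1 1
  have h₂ := h a 1
  rw [cubic_smul_add_smul, hx, hy] at h₁ h₂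
  have : a * (a - 1) * polar T x y = 0 := by linear_combination h₂ - a * h₁
  simpa [ha.1, sub_ne_zero.mpr ha.2] using this

section ScalarExtension

variable {k K V M : Type*} [Field k] [Field K] [Algebra k K] [AddCommGroup V] [Module k V]
  [AddCommGroup M] [Module K M] [Module k M] [IsScalarTower k K M]

theorem map_smul_add_smul_add_smul (ι : V →ₗ[k] M) (r s t : k) (a b c : V) :
    ι (r • a + s • b + t • c) =
      algebraMap k K r • ι a + algebraMap k K s • ι b + algebraMap k K t • ι c := by
  simp [algebraMap_smul]

/-- The cubic form `x ↦ T x x x` and its differential vanish along the subspace `W`. -/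
def VanishesOn (T : M →ₗ[K] M →ₗ[K] M →ₗ[K] K) (ι : V →ₗ[k] M) (W : Submodule k V) : Prop :=
  ∀ x ∈ W, T (ι x) (ι x) (ι x) = 0 ∧ ∀ y ∈ W, polar T (ι x) (ι y) = 0

theorem vanishesOn_span_pair [Infinite K] {T : M →ₗ[K] M →ₗ[K] M →ₗ[K] K} {ι : V →ₗ[k] M}
    {v w : V}
    (h : ∀ s t : K, T (s • ι v + t • ι w) (s • ι v + t • ι w) (s • ι v + t • ι w) = 0) :
    VanishesOn T ι (Submodule.span k {v, w}) := by
  have key : ∀ x ∈ Submodule.span k {v, w}, ∀ y ∈ Submodule.span k {v, w}, ∀ s t : K,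
      T (s • ι x + t • ι y) (s • ι x + t • ι y) (s • ι x + t • ι y) = 0 := by
    intro x hx y hy s t
    obtain ⟨a, b, rfl⟩ := Submodule.mem_span_pair.mp hx
    obtain ⟨c, d, rfl⟩ := Submodule.mem_span_pair.mp hy
    have : s • ι (a • v + b • w) + t • ι (c • v + d • w) =
        (s * algebraMap k K a + t * algebraMap k K c) • ι v +
          (s * algebraMap k K b + t * algebraMap k K d) • ι w := by
      simp only [map_add, map_smul, ← algebraMap_smul K a, ← algebraMap_smul K b,
        ← algebraMap_smul K c, ← algebraMap_smul K d]
      module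
    rw [this]
    exact h _ _
  exact fun x hx => ⟨by simpa using key x hx x hx 1 0,
    fun y hy => polar_eq_zero_of_forall_smul_add_smul (key x hx y hy)⟩

/-- The subspace of directions in `V` along which the cubic form `x ↦ T x x x` is stationary at
`v`. -/
def tangentSpace (T : M →ₗ[K] M →ₗ[K] M →ₗ[K] K) (ι : V →ₗ[k] M) (v : M) : Submodule k V where
  carrier := {y | polar T v (ι y) = 0}
  add_mem' {y z} (hy : _ = _) (hz : _ = _) := by
    simp [polar_add_right, hy, hz]
  zero_mem' := by simp [polar]
  smul_mem' c y (hy : _ = _) := by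
    rw [Set.mem_ofPred_eq, map_smul, ← algebraMap_smul K c (ι y), polar_smul_right, hy, mul_zero]

/-- A smooth cubic form does not vanish on a plane. -/
theorem not_vanish_on_plane [IsAlgClosed K] [FiniteDimensional k V]
    (hV : Module.finrank k V = 4) {T : M →ₗ[K] M →ₗ[K] M →ₗ[K] K} {ι : V →ₗ[k] M}
    (hι : ∀ a b : V, LinearIndependent k ![a, b] → LinearIndependent K ![ι a, ι b])
    (hT : ∀ v : M, T v v v = 0 → tangentSpace T ι v = ⊤ → v = 0)
    {a b c : V} (habc : LinearIndependent k ![a, b, c])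
    (ha : T (ι a) (ι a) (ι a) = 0) (hb : T (ι b) (ι b) (ι b) = 0)
    (hab : polar T (ι a) (ι b) = 0) (hba : polar T (ι b) (ι a) = 0)
    (hac : polar T (ι a) (ι c) = 0) (hbc : polar T (ι b) (ι c) = 0)
    (h : polar₃ T (ι a) (ι b) (ι c) = 0) : False := by
  obtain ⟨n, hn⟩ := exists_linearIndependent_cons_of_lt_finrank habc (by omega)
  obtain ⟨s, t, hst, hq⟩ := exists_ne_zero_quadratic_eq_zero
    (polar T (ι a) (ι n)) (polar₃ T (ι a) (ι b) (ι n)) (polar T (ι b) (ι n))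
  have hab_indep : LinearIndependent k ![a, b] := by
    have := habc.comp ![0, 1] (by decide)
    convert this using 1
    ext i
    fin_cases i <;> rfl
  have hzero : s • ι a + t • ι b = 0 := by
    apply hT
    · rw [cubic_smul_add_smul, ha, hb, hab, hba]
      ring
    · rw [eq_top_iff, ← hn.span_eq_top_of_card_eq_finrank' (by simp [hV]), Submodule.span_le]
      rintro _ ⟨i, rfl⟩
      fin_cases i <;> refine (polar_smul_add_smul_left T s t _ _ _).trans ?_
      · exact hq
      · simp [polar_self, polar₃_self_left, ha, hab, hba]
      · simp [polar_self, polar₃_self_right, hb, hab, hba]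
      · simp [h, hac, hbc]
  have := LinearIndependent.pair_iff.mp (hι a b hab_indep) s t hzero
  tauto

end ScalarExtension

section Lines

variable {k V : Type*} [Field k] [AddCommGroup V] [Module k V]

theorem eq_span_pair_of_linearIndependent {W : Submodule k V} (hW : Module.finrank k W = 2)
    {a b : V} (ha : a ∈ W) (hb : b ∈ W) (h : LinearIndependent k ![a, b]) :
    W = Submodule.span k {a, b} := by
  have : FiniteDimensional k W := .of_finrank_pos (by omega)
  refine (Submodule.eq_of_le_of_finrank_eq ?_ ?_).symm
  · rw [Submodule.span_le]
    rintro _ (rfl | rfl) <;> assumption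
  · have := finrank_span_eq_card h
    rw [Matrix.range_cons_cons_empty, Fintype.card_fin] at this
    exact this.trans hW.symm

/-- A nonzero vector of a plane extends to a basis of the plane. -/
theorem exists_linearIndependent_pair {W : Submodule k V} (hW : Module.finrank k W = 2)
    {a : V} (ha0 : a ≠ 0) : ∃ b ∈ W, LinearIndependent k ![a, b] := by
  by_contra! hcon
  have hle : W ≤ Submodule.span k {a} := by
    intro b hb
    have := hcon b hb
    rw [LinearIndependent.pair_iff' ha0] at this
    push Not at this
    exact Submodule.mem_span_singleton.mpr this
  have := Submodule.finrank_mono hle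
  have := finrank_span_singleton (K := k) ha0
  omega

theorem linearIndependent_triple {a b c : V} (hbc : LinearIndependent k ![b, c])
    (ha : a ∉ Submodule.span k {b, c}) : LinearIndependent k ![a, b, c] := by
  refine linearIndependent_finCons.mpr ⟨hbc, ?_⟩
  rwa [Matrix.range_cons_cons_empty]

theorem finrank_span_triple {a b c : V} (h : LinearIndependent k ![a, b, c]) :
    Module.finrank k (Submodule.span k {a, b, c}) = 3 := by
  have := finrank_span_eq_card h
  rwa [Matrix.range_cons, Matrix.range_cons_cons_empty, Fintype.card_fin,
    Set.singleton_union] at this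

end Lines

section Coplanar

variable {k K V M : Type*} [Field k] [Field K] [Algebra k K] [AddCommGroup V] [Module k V]
  [AddCommGroup M] [Module K M] [Module k M] [IsScalarTower k K M]

theorem exists_plane_of_concurrent [IsAlgClosed K] [FiniteDimensional k V]
    (hV : Module.finrank k V = 4) {T : M →ₗ[K] M →ₗ[K] M →ₗ[K] K} {ι : V →ₗ[k] M}
    (hι : ∀ a b : V, LinearIndependent k ![a, b] → LinearIndependent K ![ι a, ι b])
    (hT : ∀ v : M, T v v v = 0 → tangentSpace T ι v = ⊤ → v = 0)
    {W₁ W₂ W₃ : Submodule k V}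
    (hd₁ : Module.finrank k W₁ = 2) (hd₂ : Module.finrank k W₂ = 2)
    (hd₃ : Module.finrank k W₃ = 2)
    (h₁ : VanishesOn T ι W₁) (h₂ : VanishesOn T ι W₂) (h₃ : VanishesOn T ι W₃)
    (hne₁₂ : W₁ ≠ W₂) (hne₁₃ : W₁ ≠ W₃) (hne₂₃ : W₂ ≠ W₃)
    {p : V} (hp₁ : p ∈ W₁) (hp₂ : p ∈ W₂) (hp₃ : p ∈ W₃) (hp : p ≠ 0) :
    ∃ H : Submodule k V, Module.finrank k H = 3 ∧
      ∀ u ∈ H, T (ι u) (ι u) (ι u) = 0 → u ∈ W₁ ∨ u ∈ W₂ ∨ u ∈ W₃ := by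
  obtain ⟨a, ha, hpa⟩ := exists_linearIndependent_pair hd₁ hp
  obtain ⟨b, hb, hpb⟩ := exists_linearIndependent_pair hd₂ hp
  obtain ⟨c, hc, hpc⟩ := exists_linearIndependent_pair hd₃ hp
  have e₁ := eq_span_pair_of_linearIndependent hd₁ hp₁ ha hpa
  have e₂ := eq_span_pair_of_linearIndependent hd₂ hp₂ hb hpb
  have e₃ := eq_span_pair_of_linearIndependent hd₃ hp₃ hc hpc
  have hb₁ : b ∉ W₁ := fun h =>
    hne₁₂ ((eq_span_pair_of_linearIndependent hd₁ hp₁ h hpb).trans e₂.symm)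
  have hc₁ : c ∉ W₁ := fun h =>
    hne₁₃ ((eq_span_pair_of_linearIndependent hd₁ hp₁ h hpc).trans e₃.symm)
  have hc₂ : c ∉ W₂ := fun h =>
    hne₂₃ ((eq_span_pair_of_linearIndependent hd₂ hp₂ h hpc).trans e₃.symm)
  have hbpa : LinearIndependent k ![b, p, a] := linearIndependent_triple hpa (e₁ ▸ hb₁)
  have hιp : ι p ≠ 0 := (hι p a hpa).ne_zero 0
  have hcH : c ∈ Submodule.span k {b, p, a} := by
    by_contra hcon
    have hli : LinearIndependent k ![c, b, p, a] := by
      refine linearIndependent_finCons.mpr ⟨hbpa, ?_⟩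
      rwa [Matrix.range_cons, Matrix.range_cons_cons_empty, Set.singleton_union]
    refine hιp (hT _ (h₁ p hp₁).1 ?_)
    rw [eq_top_iff, ← hli.span_eq_top_of_card_eq_finrank' (by simp [hV]), Submodule.span_le]
    rintro _ ⟨i, rfl⟩
    fin_cases i
    · exact (h₃ p hp₃).2 c hc
    · exact (h₂ p hp₂).2 b hb
    · exact (h₁ p hp₁).2 p hp₁
    · exact (h₁ p hp₁).2 a ha
  obtain ⟨γ, α, β, rfl⟩ := Submodule.mem_span_triple.mp hcH
  have hβ : β ≠ 0 := by
    rintro rfl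
    exact hc₂ (by simpa using add_mem (W₂.smul_mem γ hb) (W₂.smul_mem α hp₂))
  have hγ : γ ≠ 0 := by
    rintro rfl
    exact hc₁ (by simpa using add_mem (W₁.smul_mem α hp₁) (W₁.smul_mem β ha))
  set i := algebraMap k K
  have hiβ : i β ≠ 0 := by simpa [i] using hβ
  have hiγ : i γ ≠ 0 := by simpa [i] using hγ
  have hba₃ : γ • b + β • a ∈ W₃ := by
    have := W₃.sub_mem hc (W₃.smul_mem α hp₃)
    rwa [show γ • b + α • p + β • a - α • p = γ • b + β • a by abel] at this
  have hι_ba : ι (γ • b + β • a) = i γ • ι b + i β • ι a := by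
    simp [i, algebraMap_smul]
  have hTp := (h₁ p hp₁).1
  have hTa := (h₁ a ha).1
  have hTb := (h₂ b hb).1
  have hpa0 := (h₁ p hp₁).2 a ha
  have hap0 := (h₁ a ha).2 p hp₁
  have hpb0 := (h₂ p hp₂).2 b hb
  have hbp0 := (h₂ b hb).2 p hp₂
  have hE : polar₃ T (ι b) (ι a) (ι p) = 0 := by
    have := (h₃ _ hba₃).2 p hp₃
    rw [hι_ba, polar_smul_add_smul_left, hbp0, hap0] at this
    simpa [hiβ, hiγ] using this
  have hE' : polar₃ T (ι b) (ι p) (ι a) = 0 := by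
    rw [← hE]
    simp only [polar₃]
    ring
  have hrel : i γ * polar T (ι b) (ι a) + i β * polar T (ι a) (ι b) = 0 := by
    have := (h₃ _ hba₃).1
    rw [hι_ba, cubic_smul_add_smul, hTa, hTb] at this
    refine (mul_eq_zero.mp ?_).resolve_left (mul_ne_zero hiβ hiγ)
    linear_combination this
  refine ⟨Submodule.span k {b, p, a}, finrank_span_triple hbpa, fun u hu hTu => ?_⟩
  obtain ⟨y, x, z, rfl⟩ := Submodule.mem_span_triple.mp hu
  by_contra! hcon
  obtain ⟨hu₁, hu₂, hu₃⟩ := hcon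
  have hy : i y ≠ 0 := by
    rw [map_ne_zero]
    rintro rfl
    exact hu₁ (by simpa using add_mem (W₁.smul_mem x hp₁) (W₁.smul_mem z ha))
  have hz : i z ≠ 0 := by
    rw [map_ne_zero]
    rintro rfl
    exact hu₂ (by simpa using add_mem (W₂.smul_mem y hb) (W₂.smul_mem x hp₂))
  have hdet : i y * i β - i z * i γ ≠ 0 := by
    rw [← map_mul, ← map_mul, ← map_sub, map_ne_zero]
    intro h0
    refine hu₃ ?_
    have hmem : x • p + (y * γ⁻¹) • (γ • b + β • a) ∈ W₃ :=
      add_mem (W₃.smul_mem _ hp₃) (W₃.smul_mem _ hba₃)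
    have hz' : z = y * γ⁻¹ * β := by
      field_simp
      linear_combination -h0
    have hy' : y = y * γ⁻¹ * γ := by
      field_simp
    convert hmem using 1
    rw [smul_add, smul_smul, smul_smul, ← hz', ← hy']
    abel
  have hrel' : i y * polar T (ι b) (ι a) + i z * polar T (ι a) (ι b) = 0 := by
    rw [map_smul_add_smul_add_smul (K := K), cubic_smul_add_smul_add_smul, hTa, hTb, hTp, hpa0,
      hap0, hpb0, hbp0, hE'] at hTu
    refine (mul_eq_zero.mp ?_).resolve_left (mul_ne_zero hy hz)
    linear_combination hTu
  have hba0 : polar T (ι b) (ι a) = 0 := by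
    refine (mul_eq_zero.mp ?_).resolve_left hdet
    linear_combination i β * hrel' - i z * hrel
  exact not_vanish_on_plane hV hι hT hbpa hTb hTp hbp0 hpb0 hba0 hpa0 hE'

theorem exists_plane_of_triangle [IsAlgClosed K] [FiniteDimensional k V]
    (hV : Module.finrank k V = 4) {T : M →ₗ[K] M →ₗ[K] M →ₗ[K] K} {ι : V →ₗ[k] M}
    (hι : ∀ a b : V, LinearIndependent k ![a, b] → LinearIndependent K ![ι a, ι b])
    (hT : ∀ v : M, T v v v = 0 → tangentSpace T ι v = ⊤ → v = 0)
    {W₁ W₂ W₃ : Submodule k V}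
    (hd₁ : Module.finrank k W₁ = 2)
    (h₁ : VanishesOn T ι W₁) (h₂ : VanishesOn T ι W₂) (h₃ : VanishesOn T ι W₃)
    (hi₁₂ : W₁ ⊓ W₂ ≠ ⊥) (hi₁₃ : W₁ ⊓ W₃ ≠ ⊥) (hi₂₃ : W₂ ⊓ W₃ ≠ ⊥)
    (hW : ∀ p ∈ W₁, p ∈ W₂ → p ∈ W₃ → p = 0) :
    ∃ H : Submodule k V, Module.finrank k H = 3 ∧
      ∀ u ∈ H, T (ι u) (ι u) (ι u) = 0 → u ∈ W₁ ∨ u ∈ W₂ ∨ u ∈ W₃ := by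
  obtain ⟨p, ⟨hp₁, hp₂⟩, hp⟩ := Submodule.exists_mem_ne_zero_of_ne_bot hi₁₂
  obtain ⟨q, ⟨hq₁, hq₃⟩, hq⟩ := Submodule.exists_mem_ne_zero_of_ne_bot hi₁₃
  obtain ⟨r, ⟨hr₂, hr₃⟩, hr⟩ := Submodule.exists_mem_ne_zero_of_ne_bot hi₂₃
  have hpq : LinearIndependent k ![p, q] := by
    rw [LinearIndependent.pair_iff' hp]
    rintro c rfl
    exact hq (hW _ hq₁ (W₂.smul_mem c hp₂) hq₃)
  have e₁ := eq_span_pair_of_linearIndependent hd₁ hp₁ hq₁ hpq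
  have hrpq : LinearIndependent k ![r, p, q] :=
    linearIndependent_triple hpq (e₁ ▸ fun hr₁ => hr (hW r hr₁ hr₂ hr₃))
  refine ⟨Submodule.span k {r, p, q}, finrank_span_triple hrpq, fun u hu hTu => ?_⟩
  obtain ⟨x, y, z, rfl⟩ := Submodule.mem_span_triple.mp hu
  by_contra! hcon
  obtain ⟨hu₁, hu₂, hu₃⟩ := hcon
  have hx : algebraMap k K x ≠ 0 := by
    rw [map_ne_zero]
    rintro rfl
    exact hu₁ (by simpa using add_mem (W₁.smul_mem y hp₁) (W₁.smul_mem z hq₁))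
  have hy : algebraMap k K y ≠ 0 := by
    rw [map_ne_zero]
    rintro rfl
    exact hu₃ (by simpa using add_mem (W₃.smul_mem x hr₃) (W₃.smul_mem z hq₃))
  have hz : algebraMap k K z ≠ 0 := by
    rw [map_ne_zero]
    rintro rfl
    exact hu₂ (by simpa using add_mem (W₂.smul_mem x hr₂) (W₂.smul_mem y hp₂))
  have hE : polar₃ T (ι r) (ι p) (ι q) = 0 := by
    rw [map_smul_add_smul_add_smul (K := K), cubic_smul_add_smul_add_smul, (h₂ r hr₂).1,
      (h₁ p hp₁).1, (h₁ q hq₁).1, (h₂ r hr₂).2 p hp₂, (h₂ p hp₂).2 r hr₂, (h₃ r hr₃).2 q hq₃,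
      (h₃ q hq₃).2 r hr₃, (h₁ p hp₁).2 q hq₁, (h₁ q hq₁).2 p hp₁] at hTu
    simpa [hx, hy, hz] using hTu
  exact not_vanish_on_plane hV hι hT hrpq (h₂ r hr₂).1 (h₁ p hp₁).1 ((h₂ r hr₂).2 p hp₂)
    ((h₂ p hp₂).2 r hr₂) ((h₃ r hr₃).2 q hq₃) ((h₁ p hp₁).2 q hq₁) hE

theorem meets_of_pairwise_intersecting [IsAlgClosed K] [FiniteDimensional k V]
    (hV : Module.finrank k V = 4) {T : M →ₗ[K] M →ₗ[K] M →ₗ[K] K} {ι : V →ₗ[k] M}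
    (hι : ∀ a b : V, LinearIndependent k ![a, b] → LinearIndependent K ![ι a, ι b])
    (hT : ∀ v : M, T v v v = 0 → tangentSpace T ι v = ⊤ → v = 0)
    {W₁ W₂ W₃ W : Submodule k V}
    (hd₁ : Module.finrank k W₁ = 2) (hd₂ : Module.finrank k W₂ = 2)
    (hd₃ : Module.finrank k W₃ = 2) (hd : Module.finrank k W = 2)
    (h₁ : VanishesOn T ι W₁) (h₂ : VanishesOn T ι W₂) (h₃ : VanishesOn T ι W₃)
    (h : VanishesOn T ι W)
    (hne₁₂ : W₁ ≠ W₂) (hne₁₃ : W₁ ≠ W₃) (hne₂₃ : W₂ ≠ W₃)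
    (hi₁₂ : W₁ ⊓ W₂ ≠ ⊥) (hi₁₃ : W₁ ⊓ W₃ ≠ ⊥) (hi₂₃ : W₂ ⊓ W₃ ≠ ⊥) :
    W ⊓ W₁ ≠ ⊥ ∨ W ⊓ W₂ ≠ ⊥ ∨ W ⊓ W₃ ≠ ⊥ := by
  obtain ⟨H, hH, hmem⟩ : ∃ H : Submodule k V, Module.finrank k H = 3 ∧
      ∀ u ∈ H, T (ι u) (ι u) (ι u) = 0 → u ∈ W₁ ∨ u ∈ W₂ ∨ u ∈ W₃ := by
    by_cases hW : ∀ p ∈ W₁, p ∈ W₂ → p ∈ W₃ → p = 0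
    · exact exists_plane_of_triangle hV hι hT hd₁ h₁ h₂ h₃ hi₁₂ hi₁₃ hi₂₃ hW
    · push Not at hW
      obtain ⟨p, hp₁, hp₂, hp₃, hp⟩ := hW
      exact exists_plane_of_concurrent hV hι hT hd₁ hd₂ hd₃ h₁ h₂ h₃ hne₁₂ hne₁₃ hne₂₃
        hp₁ hp₂ hp₃ hp
  have hWH : W ⊓ H ≠ ⊥ := by
    intro h0
    have hsum := Submodule.finrank_sup_add_finrank_inf_eq W H
    have hle := Submodule.finrank_le (W ⊔ H)
    rw [h0, finrank_bot] at hsum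
    omega
  obtain ⟨u, ⟨huW, huH⟩, hu⟩ := Submodule.exists_mem_ne_zero_of_ne_bot hWH
  have meets : ∀ W' : Submodule k V, u ∈ W' → W ⊓ W' ≠ ⊥ := fun W' hu' =>
    (Submodule.ne_bot_iff _).mpr ⟨u, ⟨huW, hu'⟩, hu⟩
  exact (hmem u huH (h u huW).1).imp (meets W₁) (Or.imp (meets W₂) (meets W₃))

end Coplanar

/-- Extension of scalars `kⁿ → Kⁿ`. -/
def extendScalars (k K ι : Type*) [Field k] [Field K] [Algebra k K] : (ι → k) →ₗ[k] (ι → K) :=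
  (Algebra.linearMap k K).compLeft ι

theorem linearIndependent_extendScalars {k K ι : Type*} [Field k] [Field K] [Algebra k K]
    [Finite ι] (a b : ι → k) (h : LinearIndependent k ![a, b]) :
    LinearIndependent K ![extendScalars k K ι a, extendScalars k K ι b] := by
  have := linearIndependent_algebraMap_comp_iff (S := K) (v := ![a, b]) |>.mpr h
  have e : ![extendScalars k K ι a, extendScalars k K ι b] =
      fun i => algebraMap k K ∘ ![a, b] i := by
    ext i
    fin_cases i <;> rfl
  rwa [e]

theorem eval_map_extendScalars_eq_zero {k K : Type*} [Field k] [Field K] [Algebra k K]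
    {f : MvPolynomial (Fin 4) k} {v w : Fin 4 → k} (h : lineRestrict f v w = 0) (s t : K) :
    eval (s • extendScalars k K (Fin 4) v + t • extendScalars k K (Fin 4) w)
      (map (algebraMap k K) f) = 0 := by
  have h' : aeval ![s, t] (lineRestrict f v w) = 0 := by rw [h, map_zero]
  rw [lineRestrict, ← AlgHom.comp_apply, comp_aeval] at h'
  rw [eval_map, ← aeval_def, ← h']
  congr 2
  ext i
  simp [extendScalars, mul_comm]

/-- A fourth line meets a pairwise intersecting triple of lines, where smoothness is tested over an
arbitrary algebraically closed extension `K` of `k`. -/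
theorem meets_of_smooth {k K : Type*} [Field k] [Field K] [Algebra k K] [IsAlgClosed K]
    {f : MvPolynomial (Fin 4) k} (hhom : f.IsHomogeneous 3)
    (hsmooth : ∀ x : Fin 4 → K, (eval x (map (algebraMap k K) f) = 0 ∧
      ∀ i : Fin 4, eval x (map (algebraMap k K) (pderiv i f)) = 0) → x = 0)
    {W₁ W₂ W₃ W : Submodule k (Fin 4 → k)}
    (h1 : IsLineOn f W₁) (h2 : IsLineOn f W₂) (h3 : IsLineOn f W₃) (hW : IsLineOn f W)
    (hne12 : W₁ ≠ W₂) (hne13 : W₁ ≠ W₃) (hne23 : W₂ ≠ W₃)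
    (hi12 : W₁ ⊓ W₂ ≠ ⊥) (hi13 : W₁ ⊓ W₃ ≠ ⊥) (hi23 : W₂ ⊓ W₃ ≠ ⊥) :
    W ⊓ W₁ ≠ ⊥ ∨ W ⊓ W₂ ≠ ⊥ ∨ W ⊓ W₃ ≠ ⊥ := by
  obtain ⟨T, hT, hT'⟩ := exists_trilinear_of_isHomogeneous (hhom.map (algebraMap k K))
  obtain ⟨ι, hι⟩ : ∃ ι, ι = extendScalars k K (Fin 4) := ⟨_, rfl⟩
  have vanish : ∀ W' : Submodule k (Fin 4 → k), IsLineOn f W' →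
      VanishesOn T ι W' := by
    rintro _ ⟨-, v, w, rfl, hvw⟩
    refine vanishesOn_span_pair fun s t => ?_
    rw [← hT, hι]
    exact eval_map_extendScalars_eq_zero hvw s t
  have smooth : ∀ v, T v v v = 0 → tangentSpace T ι v = ⊤ → v = 0 := by
    refine fun v hv htop => hsmooth v ⟨(hT v).trans hv, fun i => ?_⟩
    have hi : polar T v (ι (Pi.single i 1)) = 0 := by
      have : Pi.single i 1 ∈ tangentSpace T ι v := by rw [htop]; exact Submodule.mem_top
      exact this
    rw [← hT'] at hi
    simpa [hι, extendScalars, Pi.single_apply, apply_ite, pderiv_map] using hi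
  exact meets_of_pairwise_intersecting (by simp)
    (hι ▸ linearIndependent_extendScalars) smooth
    h1.1 h2.1 h3.1 hW.1 (vanish _ h1) (vanish _ h2) (vanish _ h3) (vanish _ hW)
    hne12 hne13 hne23 hi12 hi13 hi23

end CubicSurface

/-- given three distinct pairwise-intersecting `k`-lines on a smooth cubic
surface, every other `k`-line meets one of them. -/
theorem line_meets_pairwise_intersecting_triple {k : Type*} [Field k]
    (f : MvPolynomial (Fin 4) k) (hf : IsSmoothCubic k f)
    (W₁ W₂ W₃ : Submodule k (Fin 4 → k))
    (h1 : IsLineOn f W₁) (h2 : IsLineOn f W₂) (h3 : IsLineOn f W₃)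
    (hne12 : W₁ ≠ W₂) (hne13 : W₁ ≠ W₃) (hne23 : W₂ ≠ W₃)
    (hi12 : W₁ ⊓ W₂ ≠ ⊥) (hi13 : W₁ ⊓ W₃ ≠ ⊥) (hi23 : W₂ ⊓ W₃ ≠ ⊥) :
    ∀ W : Submodule k (Fin 4 → k), IsLineOn f W → W ≠ W₁ → W ≠ W₂ → W ≠ W₃ →
      W ⊓ W₁ ≠ ⊥ ∨ W ⊓ W₂ ≠ ⊥ ∨ W ⊓ W₃ ≠ ⊥ := by
  intro W hW _ _ _
  exact CubicSurface.meets_of_smooth hf.2.1 hf.2.2 h1 h2 h3 hW hne12 hne13 hne23 hi12 hi13 hi23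
end

section
/- Let f be a nonzero homogeneous polynomial of degree 3 in four variables over ℝ defining a smooth cubic surface V(f) that has exactly seven lines defined over ℝ. Then the intersection graph of these seven lines is the friendship graph F₃: the lines can be enumerated as L₀, L₁, ..., L₆ so that L₀ ∩ Lᵢ ≠ {0} for all i = 1,...,6, L₁ ∩ L₂ ≠ {0}, L₃ ∩ L₄ ≠ {0}, L₅ ∩ L₆ ≠ {0}, and all other pairs of distinct lines have intersection {0}. -/
open MvPolynomial

theorem not_and_not_of_exactly_one {P Q R : Prop}
    (h : (P ∧ ¬ Q ∧ ¬ R) ∨ (¬ P ∧ Q ∧ ¬ R) ∨ (¬ P ∧ ¬ Q ∧ R)) :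
    (P → ¬ Q ∧ ¬ R) ∧ (Q → ¬ P ∧ ¬ R) := by
  tauto

/-- A graph on seven vertices with at least one edge, in which every edge lies in a triangle
such that each vertex off it has exactly one neighbour on it, is the friendship graph `F₃`. -/
theorem exists_friendship_enumeration {α : Type*} [Fintype α] (hα : Fintype.card α = 7)
    (G : SimpleGraph α)
    (htri : ∀ a b, G.Adj a b → ∃ c, G.Adj a c ∧ G.Adj b c ∧ ∀ d, d ≠ a → d ≠ b → d ≠ c →
      (G.Adj d a ∧ ¬ G.Adj d b ∧ ¬ G.Adj d c) ∨ (¬ G.Adj d a ∧ G.Adj d b ∧ ¬ G.Adj d c) ∨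
        (¬ G.Adj d a ∧ ¬ G.Adj d b ∧ G.Adj d c))
    (hne : ∃ a b, G.Adj a b) :
    ∃ L : Fin 7 ≃ α, ∀ i j : Fin 7, i ≠ j →
      (G.Adj (L i) (L j) ↔
        (i = 0 ∨ j = 0 ∨ (i = 1 ∧ j = 2) ∨ (i = 2 ∧ j = 1) ∨
          (i = 3 ∧ j = 4) ∨ (i = 4 ∧ j = 3) ∨ (i = 5 ∧ j = 6) ∨ (i = 6 ∧ j = 5))) := by
  classical
  have hmiss : ∀ s : Finset α, s.card < 7 → ∃ x, x ∉ s := fun s hs => by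
    by_contra! h
    rw [← hα, ← Finset.card_univ] at hs
    exact hs.ne (congrArg _ (Finset.eq_univ_of_forall h))
  have hall : ∀ s : Finset α, s.card = 7 → ∀ x, x ∈ s := fun s hs x => by
    rw [Finset.eq_univ_of_card s (hs.trans hα.symm)]
    exact Finset.mem_univ x
  have key : ∃ a b c d : α, G.Adj a b ∧ G.Adj a c ∧ G.Adj b c ∧ d ≠ b ∧ d ≠ c ∧ G.Adj d a ∧
      ∀ d, d ≠ a → d ≠ b → d ≠ c →
      (G.Adj d a ∧ ¬ G.Adj d b ∧ ¬ G.Adj d c) ∨ (¬ G.Adj d a ∧ G.Adj d b ∧ ¬ G.Adj d c) ∨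
        (¬ G.Adj d a ∧ ¬ G.Adj d b ∧ G.Adj d c) := by
    obtain ⟨a, b, hab⟩ := hne
    obtain ⟨c, hac, hbc, h⟩ := htri a b hab
    obtain ⟨d, hd⟩ := hmiss {a, b, c} (Finset.card_le_three.trans_lt (by norm_num))
    simp only [Finset.mem_insert, Finset.mem_singleton, not_or] at hd
    obtain ⟨hda, hdb, hdc⟩ := hd
    rcases h d hda hdb hdc with h' | h' | h'
    · exact ⟨a, b, c, d, hab, hac, hbc, hdb, hdc, h'.1, h⟩
    · refine ⟨b, a, c, d, hab.symm, hbc, hac, hda, hdc, h'.2.1, fun x h1 h2 h3 => ?_⟩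
      have := h x h2 h1 h3
      tauto
    · refine ⟨c, a, b, d, hac.symm, hbc.symm, hab, hda, hdb, h'.2.2, fun x h1 h2 h3 => ?_⟩
      have := h x h2 h3 h1
      tauto
  obtain ⟨a, b, c, d, hab, hac, hbc, hdb, hdc, hda, habc⟩ := key
  obtain ⟨e, hde, hae, hade⟩ := htri d a hda
  have s := fun x y => G.adj_comm x y
  have hd := habc d hda.ne hdb hdc
  have heb : e ≠ b := by grind
  have hec : e ≠ c := by grind
  have he := habc e hae.ne' heb hec
  have hcard5 : ({a, b, c, d, e} : Finset α).card = 5 := by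
    simp [Finset.card_insert_of_notMem, hab.ne, hac.ne, hbc.ne, hda.ne', hde.ne, hae.ne, hdb.symm,
      hdc.symm, heb.symm, hec.symm]
  obtain ⟨f, hf⟩ := hmiss {a, b, c, d, e} (by omega)
  obtain ⟨g, hg⟩ := hmiss (insert f {a, b, c, d, e})
    (by rw [Finset.card_insert_of_notMem hf]; omega)
  have hcard7 : (insert g (insert f ({a, b, c, d, e} : Finset α))).card = 7 := by
    rw [Finset.card_insert_of_notMem hg, Finset.card_insert_of_notMem hf, hcard5]
  have hseven := hall _ hcard7
  simp only [Finset.mem_insert, Finset.mem_singleton, not_or] at hf hg hseven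
  have hf1 := habc f hf.1 hf.2.1 hf.2.2.1
  have hf2 := hade f hf.2.2.2.1 hf.1 hf.2.2.2.2
  have hg1 := habc g hg.2.1 hg.2.2.1 hg.2.2.2.1
  have hg2 := hade g hg.2.2.2.2.1 hg.2.1 hg.2.2.2.2.2
  have hne : ∀ x y, G.Adj x y → x ≠ y := fun x y h => h.ne
  have hirr : ∀ x, ¬ G.Adj x x := fun x => G.irrefl
  have hbd : ¬ G.Adj b d ∧ ¬ G.Adj c d ∧ ¬ G.Adj b e ∧ ¬ G.Adj c e := by
    rw [s b, s c, s b, s c]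
    clear * - hd he hda hae
    have := hae.symm
    tauto
  have hfb : ∀ b', (b' = b ∨ b' = c) → ¬ G.Adj f b' := by
    intro b' hb' hfb'
    obtain ⟨x, hx1, hx2, hx⟩ := htri f b' hfb'
    have hfa : ¬ G.Adj f a := by
      clear * - hb' hf1 hfb'
      rcases hb' with rfl | rfl <;> tauto
    have hbd' : ¬ G.Adj b' d ∧ ¬ G.Adj b' e := by
      clear * - hb' hbd
      rcases hb' with rfl | rfl <;> tauto
    have hfbc : ∀ y, (y = b ∨ y = c) → G.Adj f y → y = b' := by
      clear * - hb' hf1 hfb'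
      rintro y (rfl | rfl) hy <;> rcases hb' with rfl | rfl <;> first | rfl | tauto
    have hxg : x = g := by
      rcases hseven x with rfl | rfl | rfl | rfl | rfl | rfl | rfl
      · rfl
      · exact (hirr _ hx1).elim
      · exact (hfa hx1).elim
      · exact (hirr _ (hfbc _ (.inl rfl) hx1 ▸ hx2)).elim
      · exact (hirr _ (hfbc _ (.inr rfl) hx1 ▸ hx2)).elim
      · exact (hbd'.1 hx2).elim
      · exact (hbd'.2 hx2).elim
    subst hxg
    have hda' : ∀ y, (y = f ∨ y = x) → ¬ G.Adj y a := by
      rintro y (rfl | rfl)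
      · exact hfa
      · have := hx2.symm
        clear * - this hb' hg1
        rcases hb' with rfl | rfl <;> tauto
    have hdx := hx d (Ne.symm hf.2.2.2.1) (by rcases hb' with rfl | rfl <;> assumption)
      (Ne.symm hg.2.2.2.2.1)
    have hfin : ∀ y z, (y = f ∧ z = x ∨ y = x ∧ z = f) → ¬ G.Adj d y := by
      intro y z hyz hdy
      have hya : ¬ G.Adj y a := hda' y (by clear * - hyz; tauto)
      have hdz : ¬ G.Adj d z := by
        clear * - hyz hdx hdy
        rcases hyz with ⟨rfl, rfl⟩ | ⟨rfl, rfl⟩ <;> tauto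
      have hye : ¬ G.Adj y e := by
        have := G.adj_comm y d
        clear * - this hyz hf2 hg2 hdy
        rcases hyz with ⟨rfl, rfl⟩ | ⟨rfl, rfl⟩ <;> tauto
      obtain ⟨w, hw1, hw2, -⟩ := htri _ _ hdy
      have hw : w = y ∨ w = z ∨ w = a ∨ w = b ∨ w = c ∨ w = d ∨ w = e := by
        have := hseven w
        clear * - this hyz
        rcases hyz with ⟨rfl, rfl⟩ | ⟨rfl, rfl⟩ <;> tauto
      rcases hw with rfl | rfl | rfl | rfl | rfl | rfl | rfl
      · exact hirr _ hw2
      · exact hdz hw1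
      · exact hya hw2
      · exact hbd.1 hw1.symm
      · exact hbd.2.1 hw1.symm
      · exact hirr _ hw1
      · exact hye hw2
    have h1 := hfin f x (.inl ⟨rfl, rfl⟩)
    have h2 := hfin x f (.inr ⟨rfl, rfl⟩)
    rw [s d b'] at hdx
    clear * - hdx h1 h2 hbd'
    tauto
  have hfa : G.Adj f a := by
    have h1 := hfb b (.inl rfl)
    have h2 := hfb c (.inr rfl)
    clear * - h1 h2 hf1
    tauto
  obtain ⟨x, hx1, hx2, hx⟩ := htri f a hfa
  have hxg : x = g := by
    rcases hseven x with rfl | rfl | rfl | rfl | rfl | rfl | rfl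
    · rfl
    · exact (hirr _ hx1).elim
    · exact (hirr _ hx2).elim
    · exact (hfb _ (.inl rfl) hx1).elim
    · exact (hfb _ (.inr rfl) hx1).elim
    all_goals
      clear * - hx1 hf2 hfa
      tauto
  subst hxg
  let L : Fin 7 → α := ![a, b, c, d, e, f, x]
  have hsurj : Function.Surjective L := fun y => by
    rcases hseven y with h | h | h | h | h | h | h
    exacts [⟨6, h.symm⟩, ⟨5, h.symm⟩, ⟨0, h.symm⟩, ⟨1, h.symm⟩, ⟨2, h.symm⟩, ⟨3, h.symm⟩,
      ⟨4, h.symm⟩]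
  have hbij : Function.Bijective L :=
    (Fintype.bijective_iff_surjective_and_card L).2 ⟨hsurj, by simp [hα]⟩
  refine ⟨Equiv.ofBijective L hbij, fun i j hij => ?_⟩
  have hxa : G.Adj x a := hx2.symm
  have hea : G.Adj e a := hae.symm
  obtain ⟨h1, h2⟩ := (not_and_not_of_exactly_one hd).1 hda
  obtain ⟨h3, h4⟩ := (not_and_not_of_exactly_one he).1 hea
  obtain ⟨h5, h6⟩ := (not_and_not_of_exactly_one hf1).1 hfa
  obtain ⟨h7, h8⟩ := (not_and_not_of_exactly_one hg1).1 hxa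
  obtain ⟨h9, h10⟩ := (not_and_not_of_exactly_one hf2).2 hfa
  obtain ⟨h11, h12⟩ := (not_and_not_of_exactly_one hg2).2 hxa
  simp only [Equiv.ofBijective_apply, L]
  wlog h : i < j generalizing i j
  · refine (G.adj_comm _ _).trans
      ((this j i hij.symm (lt_of_le_of_ne (not_lt.1 h) hij.symm)).trans ?_)
    clear * -
    tauto
  fin_cases i <;> fin_cases j <;> simp at h hij ⊢ <;> first
    | assumption
    | (apply SimpleGraph.Adj.symm; assumption)
    | (rw [G.adj_comm]; assumption)

open Module Submodule

theorem Submodule.inf_ne_bot_of_finrank_lt {K V : Type*} [Field K] [AddCommGroup V] [Module K V]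
    [FiniteDimensional K V] {S T H : Submodule K V} (hS : S ≤ H) (hT : T ≤ H)
    (h : finrank K H < finrank K S + finrank K T) : S ⊓ T ≠ ⊥ := by
  intro h0
  have h1 := Submodule.finrank_sup_add_finrank_inf_eq S T
  have h2 := Submodule.finrank_mono (sup_le hS hT)
  rw [h0, finrank_bot] at h1
  omega

theorem Submodule.exists_coordinates_of_finrank_eq_two {K V : Type*} [Field K] [AddCommGroup V]
    [Module K V] [FiniteDimensional K V] {A : Submodule K V} (hA : finrank K A = 2) {p : V}
    (hp : p ∈ A) (hp0 : p ≠ 0) :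
    ∃ a ∈ A, LinearIndependent K ![p, a] ∧ A = span K {p, a} := by
  obtain ⟨a, ha, hap⟩ : ∃ a ∈ A, a ∉ span K {p} := by
    by_contra! h
    have := Submodule.finrank_mono (show A ≤ span K {p} from h)
    rw [finrank_span_singleton hp0] at this
    omega
  have hli : LinearIndependent K ![p, a] := by
    rw [LinearIndependent.pair_iff' hp0]
    intro c hc
    exact hap (mem_span_singleton.2 ⟨c, hc⟩)
  refine ⟨a, ha, hli, (Submodule.eq_of_le_of_finrank_eq ?_ ?_).symm⟩
  · rw [span_le]
    rintro x (rfl | rfl) <;> assumption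
  · have := finrank_span_eq_card hli
    rw [Matrix.range_cons_cons_empty] at this
    rw [this, hA, Fintype.card_fin]

theorem Submodule.le_or_le_or_le_of_forall_mem {K V : Type*} [Field K] [Infinite K]
    [AddCommGroup V] [Module K V] {S A B C : Submodule K V}
    (h : ∀ x ∈ S, x ∈ A ∨ x ∈ B ∨ x ∈ C) : S ≤ A ∨ S ≤ B ∨ S ≤ C := by
  obtain ⟨i, hi⟩ := Subspace.exists_eq_top_of_iUnion_eq_univ
    (p := ![A.comap S.subtype, B.comap S.subtype, C.comap S.subtype]) (by
      ext x
      simpa [Fin.exists_fin_succ] using h x x.2)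
  fin_cases i
  · exact .inl (comap_subtype_eq_top.1 hi)
  · exact .inr (.inl (comap_subtype_eq_top.1 hi))
  · exact .inr (.inr (comap_subtype_eq_top.1 hi))

/-- A symmetric trilinear form whose cubic form vanishes on a subspace vanishes there. -/
theorem trilinear_eq_zero_of_cube_eq_zero {V : Type*} [AddCommGroup V] [Module ℝ V]
    {T : V →ₗ[ℝ] V →ₗ[ℝ] V →ₗ[ℝ] ℝ} (hl : ∀ x y z, T x y z = T y x z)
    (hr : ∀ x y z, T x y z = T x z y) {A : Submodule ℝ V} (h : ∀ x ∈ A, T x x x = 0) {x y z : V}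
    (hx : x ∈ A) (hy : y ∈ A) (hz : z ∈ A) : T x y z = 0 := by
  have hxxy : ∀ x ∈ A, ∀ y ∈ A, T x x y = 0 := fun x hx y hy => by
    have h1 := h _ (A.add_mem hx hy)
    have h2 := h _ (A.sub_mem hx hy)
    have h3 := h _ hx
    have h4 := h _ hy
    simp only [map_add, map_sub, LinearMap.add_apply, LinearMap.sub_apply] at h1 h2
    linarith [hl y x x, hr x y x, hr y x y, hl x y y]
  have h1 := hxxy _ (A.add_mem hx hy) z hz
  simp only [map_add, LinearMap.add_apply, hxxy x hx z hz, hxxy y hy z hz, hl y x z] at h1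
  linarith

/-- A symmetric trilinear form on a four-dimensional real vector space whose cubic form
`x ↦ T x x x` defines a smooth projective surface: the tangent planes exist at all real points,
and no plane is tangent to the surface along a whole line. -/
structure SmoothCubicForm (V : Type*) [AddCommGroup V] [Module ℝ V] where
  /-- the polarization of the cubic form -/
  toFun : V →ₗ[ℝ] V →ₗ[ℝ] V →ₗ[ℝ] ℝ
  comm_left : ∀ x y z, toFun x y z = toFun y x z
  comm_right : ∀ x y z, toFun x y z = toFun x z y
  finrank_eq : finrank ℝ V = 4
  eq_zero_of_tangent : ∀ x, toFun x x = 0 → x = 0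
  mem_of_tangent_along : ∀ (A : Submodule ℝ V) (b : V), finrank ℝ A = 2 →
    (∀ x ∈ A, toFun x x x = 0) → (∀ x ∈ A, ∀ y ∈ A, toFun x y b = 0) → b ∈ A

namespace SmoothCubicForm

variable {V : Type*} [AddCommGroup V] [Module ℝ V]

/-- A line on the surface, as a plane in the ambient vector space. -/
def IsLine (T : SmoothCubicForm V) (W : Submodule ℝ V) : Prop :=
  finrank ℝ W = 2 ∧ ∀ x ∈ W, T.toFun x x x = 0

theorem finiteDimensional (T : SmoothCubicForm V) : FiniteDimensional ℝ V :=
  .of_finrank_eq_succ T.finrank_eq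

variable {T : SmoothCubicForm V}

theorem IsLine.apply_eq_zero {A : Submodule ℝ V} (hA : T.IsLine A) {x y z : V} (hx : x ∈ A)
    (hy : y ∈ A) (hz : z ∈ A) : T.toFun x y z = 0 :=
  trilinear_eq_zero_of_cube_eq_zero T.comm_left T.comm_right hA.2 hx hy hz

theorem finrank_sup_of_isLine {A B : Submodule ℝ V} (hA : T.IsLine A) (hB : T.IsLine B)
    (hne : A ≠ B) (h : A ⊓ B ≠ ⊥) : finrank ℝ ↥(A ⊔ B) = 3 := by
  have := T.finiteDimensional
  have h1 := Submodule.finrank_sup_add_finrank_inf_eq A B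
  have h2 : finrank ℝ ↥(A ⊓ B) ≠ 0 := fun h0 => h (finrank_eq_zero.1 h0)
  have h3 : A ⊓ B < A := by
    refine lt_of_le_of_ne inf_le_left fun h0 => hne ?_
    exact eq_of_le_of_finrank_eq (inf_eq_left.1 h0) (hA.1.trans hB.1.symm)
  have h4 := Submodule.finrank_lt_finrank_of_lt h3
  rw [hA.1, hB.1] at h1
  rw [hA.1] at h4
  omega

/-- Two lines of the surface met by a third one, in the plane they span or otherwise:
the third line lies in that plane. -/
theorem IsLine.le_sup {A B D : Submodule ℝ V} (hA : T.IsLine A) (hB : T.IsLine B)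
    (hD : T.IsLine D) (hne : A ≠ B) (hAB : A ⊓ B ≠ ⊥) (hDA : D ⊓ A ≠ ⊥) (hDB : D ⊓ B ≠ ⊥) :
    D ≤ A ⊔ B := by
  have := T.finiteDimensional
  have h3 := finrank_sup_of_isLine hA hB hne hAB
  obtain ⟨x, ⟨hxD, hxA⟩, hx0⟩ := (Submodule.ne_bot_iff _).1 hDA
  obtain ⟨y, ⟨hyD, hyB⟩, hy0⟩ := (Submodule.ne_bot_iff _).1 hDB
  by_cases hxB : x ∈ B
  · have hker : finrank ℝ (LinearMap.ker (T.toFun x x)) + 1 = 4 := by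
      rw [← T.finrank_eq]
      exact Module.Dual.finrank_ker_add_one_of_ne_zero
        fun h => hx0 (T.eq_zero_of_tangent x h)
    have hle : ∀ W, T.IsLine W → x ∈ W → W ≤ LinearMap.ker (T.toFun x x) :=
      fun W hW hxW z hz => hW.apply_eq_zero hxW hxW hz
    rw [eq_of_le_of_finrank_eq (sup_le (hle A hA hxA) (hle B hB hxB)) (by omega)]
    exact hle D hD hxD
  · have hli : LinearIndependent ℝ ![y, x] := by
      rw [LinearIndependent.pair_iff' hy0]
      rintro c rfl
      exact hxB (B.smul_mem c hyB)
    have hspan : span ℝ {y, x} = D := by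
      refine eq_of_le_of_finrank_eq ?_ ?_
      · rw [span_le]
        rintro z (rfl | rfl) <;> assumption
      · have := finrank_span_eq_card hli
        rw [Matrix.range_cons_cons_empty] at this
        rw [this, hD.1, Fintype.card_fin]
    rw [← hspan, span_le]
    rintro z (rfl | rfl)
    · exact mem_sup_right hyB
    · exact mem_sup_left hxA

/-- The plane spanned by two intersecting lines cuts the surface in three distinct lines. -/
theorem IsLine.exists_third {A B : Submodule ℝ V} (hA : T.IsLine A) (hB : T.IsLine B)
    (hne : A ≠ B) (hAB : A ⊓ B ≠ ⊥) :
    ∃ C, T.IsLine C ∧ C ≠ A ∧ C ≠ B ∧ C ≤ A ⊔ B ∧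
      ∀ x ∈ A ⊔ B, T.toFun x x x = 0 → x ∈ A ∨ x ∈ B ∨ x ∈ C := by
  have := T.finiteDimensional
  obtain ⟨p, ⟨hpA, hpB⟩, hp0⟩ := (Submodule.ne_bot_iff _).1 hAB
  obtain ⟨a, haA, -, hA'⟩ := exists_coordinates_of_finrank_eq_two hA.1 hpA hp0
  obtain ⟨b, hbB, -, hB'⟩ := exists_coordinates_of_finrank_eq_two hB.1 hpB hp0
  have hbA : b ∉ A := fun h => hne <| (eq_of_le_of_finrank_eq (S₁ := B) (by
    rw [hB', span_le]; rintro z (rfl | rfl) <;> assumption) (hB.1.trans hA.1.symm)).symm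
  have haB : a ∉ B := fun h => hne <| (eq_of_le_of_finrank_eq (S₁ := A) (by
    rw [hA', span_le]; rintro z (rfl | rfl) <;> assumption) (hA.1.trans hB.1.symm))
  let φ : (Fin 3 → ℝ) →ₗ[ℝ] V := Fintype.linearCombination ℝ ![p, a, b]
  have hφ : ∀ c, φ c = c 0 • p + c 1 • a + c 2 • b := fun c => by
    simp [φ, Fintype.linearCombination_apply, Fin.sum_univ_three]
  have hφrange : LinearMap.range φ = A ⊔ B := by
    apply le_antisymm
    · rintro _ ⟨c, rfl⟩
      rw [hφ]
      exact add_mem (mem_sup_left (A.add_mem (A.smul_mem _ hpA) (A.smul_mem _ haA)))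
        (mem_sup_right (B.smul_mem _ hbB))
    · rw [hA', hB', sup_le_iff, span_le, span_le]
      constructor
      · rintro z (rfl | rfl)
        · exact ⟨![1, 0, 0], by simp [hφ]⟩
        · exact ⟨![0, 1, 0], by simp [hφ]⟩
      · rintro z (rfl | rfl)
        · exact ⟨![1, 0, 0], by simp [hφ]⟩
        · exact ⟨![0, 0, 1], by simp [hφ]⟩
  have hinj : Function.Injective φ := by
    rw [← LinearMap.ker_eq_bot, ← Submodule.finrank_eq_zero]
    have h1 := φ.finrank_range_add_finrank_ker
    rw [hφrange, finrank_sup_of_isLine hA hB hne hAB, finrank_fin_fun] at h1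
    omega
  let g : (Fin 3 → ℝ) →ₗ[ℝ] ℝ := Fintype.linearCombination ℝ
    ![2 * T.toFun p a b, T.toFun a a b, T.toFun a b b]
  have hg : ∀ c, g c = c 0 * (2 * T.toFun p a b) + c 1 * T.toFun a a b + c 2 * T.toFun a b b :=
    fun c => by simp [g, Fintype.linearCombination_apply, Fin.sum_univ_three]
  have hcube : ∀ c, T.toFun (φ c) (φ c) (φ c) = 3 * c 1 * c 2 * g c := fun c => by
    have h1 := hA.apply_eq_zero hpA hpA hpA
    have h2 := hA.apply_eq_zero hpA hpA haA
    have h3 := hA.apply_eq_zero hpA haA haA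
    have h4 := hA.apply_eq_zero haA haA haA
    have h5 := hB.apply_eq_zero hpB hpB hbB
    have h6 := hB.apply_eq_zero hpB hbB hbB
    have h7 := hB.apply_eq_zero hbB hbB hbB
    simp only [hφ, hg, map_add, map_smul, LinearMap.add_apply, LinearMap.smul_apply, smul_eq_mul]
    rw [T.comm_right p a p, T.comm_right p b p, T.comm_right p b a, T.comm_left a p p,
      T.comm_right p a p, T.comm_left a p a, T.comm_left a p b, T.comm_right a a p,
      T.comm_left a p a, T.comm_right a b p, T.comm_left a p b, T.comm_right a b a,
      T.comm_left b p p, T.comm_right p b p, T.comm_left b p a, T.comm_right p b a,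
      T.comm_left b p b, T.comm_left b a p, T.comm_right a b p, T.comm_left a p b,
      T.comm_left b a a, T.comm_right a b a, T.comm_left b a b, T.comm_right b b p,
      T.comm_left b p b, T.comm_right b b a, T.comm_left b a b, h1, h2, h3, h4, h5, h6, h7]
    ring
  have hgA : T.toFun p a b ≠ 0 ∨ T.toFun a a b ≠ 0 := by
    by_contra! h
    refine hbA (T.mem_of_tangent_along A b hA.1 hA.2 fun x hx y hy => ?_)
    rw [hA', mem_span_pair] at hx hy
    obtain ⟨x0, x1, rfl⟩ := hx
    obtain ⟨y0, y1, rfl⟩ := hy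
    simp [T.comm_left a p b, h, hB.apply_eq_zero hpB hpB hbB]
  have hgB : T.toFun p a b ≠ 0 ∨ T.toFun a b b ≠ 0 := by
    by_contra! h
    refine haB (T.mem_of_tangent_along B a hB.1 hB.2 fun x hx y hy => ?_)
    rw [hB', mem_span_pair] at hx hy
    obtain ⟨x0, x1, rfl⟩ := hx
    obtain ⟨y0, y1, rfl⟩ := hy
    simp [T.comm_left b p a, T.comm_right p b a, T.comm_right b b a, T.comm_left b a b, h,
      hA.apply_eq_zero hpA hpA haA]
  have hg0 : g ≠ 0 := fun h => by
    have h0 : g ![1, 0, 0] = 0 := by rw [h]; rfl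
    have h1 : g ![0, 1, 0] = 0 := by rw [h]; rfl
    simp [hg] at h0 h1
    tauto
  have hmem : ∀ c, φ c ∈ (LinearMap.ker g).map φ ↔ g c = 0 := fun c =>
    ⟨fun ⟨d, hd, hdc⟩ => hinj hdc ▸ hd, fun h => ⟨c, h, rfl⟩⟩
  have hmp := hmem ![1, 0, 0]
  have hma := hmem ![0, 1, 0]
  have hmb := hmem ![0, 0, 1]
  simp [hφ, hg, -Submodule.mem_map] at hmp hma hmb
  refine ⟨(LinearMap.ker g).map φ, ⟨?_, ?_⟩, ?_, ?_, ?_, ?_⟩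
  · rw [← (Submodule.equivMapOfInjective φ hinj (LinearMap.ker g)).finrank_eq]
    have := Module.Dual.finrank_ker_add_one_of_ne_zero hg0
    rw [finrank_fin_fun] at this
    omega
  · rintro _ ⟨c, hc, rfl⟩
    rw [hcube, show g c = 0 from hc, mul_zero]
  · intro h
    rw [h] at hmp hma
    tauto
  · intro h
    rw [h] at hmp hmb
    tauto
  · rw [← hφrange]
    exact LinearMap.map_le_range
  · rw [← hφrange]
    rintro _ ⟨c, rfl⟩ hx
    rw [hcube, mul_eq_zero, mul_eq_zero, mul_eq_zero] at hx
    rcases hx with ((h | h) | h) | h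
    · norm_num at h
    · refine .inr (.inl ?_)
      rw [hφ, h, zero_smul, add_zero]
      exact B.add_mem (B.smul_mem _ hpB) (B.smul_mem _ hbB)
    · refine .inl ?_
      rw [hφ, h, zero_smul, add_zero]
      exact A.add_mem (A.smul_mem _ hpA) (A.smul_mem _ haA)
    · exact .inr (.inr ((hmem c).2 h))

theorem IsLine.eq_of_le {A B : Submodule ℝ V} (hA : T.IsLine A) (hB : T.IsLine B) (h : A ≤ B) :
    A = B :=
  have := T.finiteDimensional
  eq_of_le_of_finrank_eq h (hA.1.trans hB.1.symm)

/-- The graph of lines of the surface, with edges the pairs of intersecting lines. -/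
def lineGraph (T : SmoothCubicForm V) : SimpleGraph {W // T.IsLine W} where
  Adj A B := A ≠ B ∧ A.1 ⊓ B.1 ≠ ⊥
  symm := ⟨fun A B h => ⟨h.1.symm, by rw [inf_comm]; exact h.2⟩⟩
  loopless := ⟨fun A h => h.1 rfl⟩

/-- Every edge of the line graph lies in a triangle met exactly once by all the other lines. -/
theorem exists_triangle (A B : {W // T.IsLine W}) (h : T.lineGraph.Adj A B) :
    ∃ C, T.lineGraph.Adj A C ∧ T.lineGraph.Adj B C ∧ ∀ D, D ≠ A → D ≠ B → D ≠ C →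
      (T.lineGraph.Adj D A ∧ ¬ T.lineGraph.Adj D B ∧ ¬ T.lineGraph.Adj D C) ∨
      (¬ T.lineGraph.Adj D A ∧ T.lineGraph.Adj D B ∧ ¬ T.lineGraph.Adj D C) ∨
      (¬ T.lineGraph.Adj D A ∧ ¬ T.lineGraph.Adj D B ∧ T.lineGraph.Adj D C) := by
  have := T.finiteDimensional
  obtain ⟨hne, hAB⟩ := h
  have hne' : A.1 ≠ B.1 := fun h => hne (Subtype.ext h)
  obtain ⟨C, hC, hCA, hCB, hCle, hcov⟩ := A.2.exists_third B.2 hne' hAB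
  have h3 := finrank_sup_of_isLine A.2 B.2 hne' hAB
  have hAC : A.1 ⊓ C ≠ ⊥ := inf_ne_bot_of_finrank_lt le_sup_left hCle (by
    rw [h3, A.2.1, hC.1]; norm_num)
  have hBC : B.1 ⊓ C ≠ ⊥ := inf_ne_bot_of_finrank_lt le_sup_right hCle (by
    rw [h3, B.2.1, hC.1]; norm_num)
  refine ⟨⟨C, hC⟩, ⟨fun h => hCA (congrArg Subtype.val h).symm, hAC⟩,
    ⟨fun h => hCB (congrArg Subtype.val h).symm, hBC⟩, fun D hDA hDB hDC => ?_⟩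
  have hDle : ¬ D.1 ≤ A.1 ⊔ B.1 := fun hle => by
    rcases le_or_le_or_le_of_forall_mem fun x hx => hcov x (hle hx) (D.2.2 x hx) with h | h | h
    · exact hDA (Subtype.ext (D.2.eq_of_le A.2 h))
    · exact hDB (Subtype.ext (D.2.eq_of_le B.2 h))
    · exact hDC (Subtype.ext (D.2.eq_of_le hC h))
  have hex : D.1 ⊓ A.1 ≠ ⊥ ∨ D.1 ⊓ B.1 ≠ ⊥ ∨ D.1 ⊓ C ≠ ⊥ := by
    have := inf_ne_bot_of_finrank_lt (S := D.1) (T := A.1 ⊔ B.1) le_top le_top (by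
      rw [finrank_top, T.finrank_eq, D.2.1, h3]; norm_num)
    obtain ⟨x, ⟨hxD, hx⟩, hx0⟩ := (Submodule.ne_bot_iff _).1 this
    rcases hcov x hx (D.2.2 x hxD) with h | h | h
    · exact .inl ((Submodule.ne_bot_iff _).2 ⟨x, ⟨hxD, h⟩, hx0⟩)
    · exact .inr (.inl ((Submodule.ne_bot_iff _).2 ⟨x, ⟨hxD, h⟩, hx0⟩))
    · exact .inr (.inr ((Submodule.ne_bot_iff _).2 ⟨x, ⟨hxD, h⟩, hx0⟩))
  have h1 : ¬ (D.1 ⊓ A.1 ≠ ⊥ ∧ D.1 ⊓ B.1 ≠ ⊥) := fun h =>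
    hDle (A.2.le_sup B.2 D.2 hne' hAB h.1 h.2)
  have h2 : ¬ (D.1 ⊓ A.1 ≠ ⊥ ∧ D.1 ⊓ C ≠ ⊥) := fun h =>
    hDle ((A.2.le_sup hC D.2 hCA.symm hAC h.1 h.2).trans (sup_le le_sup_left hCle))
  have h3 : ¬ (D.1 ⊓ B.1 ≠ ⊥ ∧ D.1 ⊓ C ≠ ⊥) := fun h =>
    hDle ((B.2.le_sup hC D.2 hCB.symm hBC h.1 h.2).trans (sup_le le_sup_right hCle))
  have e1 : T.lineGraph.Adj D A ↔ D.1 ⊓ A.1 ≠ ⊥ := and_iff_right hDA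
  have e2 : T.lineGraph.Adj D B ↔ D.1 ⊓ B.1 ≠ ⊥ := and_iff_right hDB
  have e3 : T.lineGraph.Adj D ⟨C, hC⟩ ↔ D.1 ⊓ C ≠ ⊥ := and_iff_right hDC
  rw [e1, e2, e3]
  clear * - hex h1 h2 h3
  tauto

/-- Twice the matrix of the conic residual to the line `span {v, w}` in the plane
`span {v, w, u}`, with respect to the coordinates given by `v`, `w` and `u`. -/
def residualMatrix (T : SmoothCubicForm V) (v w u : V) : Matrix (Fin 3) (Fin 3) ℝ :=
  !![6 * T.toFun v v u, 6 * T.toFun v w u, 3 * T.toFun v u u;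
    6 * T.toFun v w u, 6 * T.toFun w w u, 3 * T.toFun w u u;
    3 * T.toFun v u u, 3 * T.toFun w u u, 2 * T.toFun u u u]

/-- The discriminant of the residual conic is a binary quintic on a pencil of planes through a
line, so it vanishes somewhere. -/
theorem exists_det_residualMatrix_eq_zero (T : SmoothCubicForm V) (v w y z : V) :
    ∃ θ : ℝ, (T.residualMatrix v w (Real.cos θ • y + Real.sin θ • z)).det = 0 := by
  let D : ℝ → ℝ := fun θ => (T.residualMatrix v w (Real.cos θ • y + Real.sin θ • z)).det
  have hD : Continuous D := by
    simp only [D, residualMatrix, Matrix.det_fin_three, map_add, map_smul, LinearMap.add_apply,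
      LinearMap.smul_apply, smul_eq_mul, Matrix.of_apply, Matrix.cons_val', Matrix.cons_val_zero,
      Matrix.cons_val_one, Matrix.cons_val]
    fun_prop
  have hodd : D Real.pi = - D 0 := by
    simp [D, residualMatrix, Matrix.det_fin_three]
    ring
  rcases le_total (D 0) 0 with h | h
  · obtain ⟨θ, -, hθ⟩ := intermediate_value_Icc Real.pi_nonneg hD.continuousOn
      (show (0 : ℝ) ∈ Set.Icc (D 0) (D Real.pi) from ⟨h, by rw [hodd]; linarith⟩)
    exact ⟨θ, hθ⟩
  · obtain ⟨θ, -, hθ⟩ := intermediate_value_Icc' Real.pi_nonneg hD.continuousOn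
      (show (0 : ℝ) ∈ Set.Icc (D Real.pi) (D 0) from ⟨by rw [hodd]; linarith, h⟩)
    exact ⟨θ, hθ⟩

theorem IsLine.cube_eq_residual {A : Submodule ℝ V} (hA : T.IsLine A) {v w : V} (hv : v ∈ A)
    (hw : w ∈ A) (u : V) (c : Fin 3 → ℝ) :
    2 * T.toFun (c 0 • v + c 1 • w + c 2 • u) (c 0 • v + c 1 • w + c 2 • u)
      (c 0 • v + c 1 • w + c 2 • u) = c 2 * (c ⬝ᵥ (T.residualMatrix v w u).mulVec c) := by
  have h1 := hA.apply_eq_zero hv hv hv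
  have h2 := hA.apply_eq_zero hv hv hw
  have h3 := hA.apply_eq_zero hv hw hw
  have h4 := hA.apply_eq_zero hw hw hw
  simp only [residualMatrix, map_add, map_smul, LinearMap.add_apply, LinearMap.smul_apply,
    smul_eq_mul, Matrix.mulVec, dotProduct, Fin.sum_univ_three, Matrix.of_apply, Matrix.cons_val',
    Matrix.cons_val_zero, Matrix.cons_val_one, Matrix.cons_val]
  rw [T.comm_right v w v, T.comm_right v u v, T.comm_right v u w, T.comm_left w v v,
    T.comm_right v w v, T.comm_left w v w, T.comm_left w v u, T.comm_right w w v,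
    T.comm_left w v w, T.comm_right w u v, T.comm_left w v u, T.comm_right w u w,
    T.comm_left u v v, T.comm_right v u v, T.comm_left u v w, T.comm_right v u w,
    T.comm_left u v u, T.comm_left u w v, T.comm_right w u v, T.comm_left w v u,
    T.comm_left u w w, T.comm_right w u w, T.comm_left u w u, T.comm_right u u v,
    T.comm_left u v u, T.comm_right u u w, T.comm_left u w u, h1, h2, h3, h4]
  ring

/-- A line skew to two further skew lines meets some line of the surface. -/
theorem IsLine.exists_inf_ne_bot {A B C : Submodule ℝ V} (hA : T.IsLine A) (hB : T.IsLine B)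
    (hC : T.IsLine C) (hAB : A ⊓ B = ⊥) (hAC : A ⊓ C = ⊥) (hBC : B ⊓ C = ⊥) :
    ∃ W, T.IsLine W ∧ A ≠ W ∧ A ⊓ W ≠ ⊥ := by
  have := T.finiteDimensional
  have hpos : ∀ W : Submodule ℝ V, finrank ℝ W = 2 → ∃ p ∈ W, p ≠ 0 := fun W hW =>
    (Submodule.ne_bot_iff _).1 fun h => by rw [h, finrank_bot] at hW; norm_num at hW
  obtain ⟨v, hvA, hv0⟩ := hpos A hA.1
  obtain ⟨w, hwA, hvw, hspanA⟩ := exists_coordinates_of_finrank_eq_two hA.1 hvA hv0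
  obtain ⟨Q, hQ⟩ := A.exists_isCompl
  have hQ2 : finrank ℝ Q = 2 := by
    have := Submodule.finrank_add_eq_of_isCompl hQ
    rw [hA.1, T.finrank_eq] at this
    omega
  obtain ⟨y, hyQ, hy0⟩ := hpos Q hQ2
  obtain ⟨z, hzQ, hyz, -⟩ := exists_coordinates_of_finrank_eq_two hQ2 hyQ hy0
  obtain ⟨θ, hθ⟩ := T.exists_det_residualMatrix_eq_zero v w y z
  rw [LinearIndependent.pair_iff] at hvw hyz
  set u := Real.cos θ • y + Real.sin θ • z with hu
  have huQ : u ∈ Q := Q.add_mem (Q.smul_mem _ hyQ) (Q.smul_mem _ hzQ)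
  have hu0 : u ≠ 0 := fun h => by
    have h1 := hyz _ _ h
    have h2 := Real.sin_sq_add_cos_sq θ
    rw [h1.1, h1.2] at h2
    norm_num at h2
  have huA : u ∉ A := fun h => hu0 (Submodule.disjoint_def.1 hQ.disjoint u h huQ)
  obtain ⟨k, hk0, hk⟩ := Matrix.exists_mulVec_eq_zero_iff.2 hθ
  let φ : (Fin 3 → ℝ) →ₗ[ℝ] V := Fintype.linearCombination ℝ ![v, w, u]
  have hφ : ∀ c, φ c = c 0 • v + c 1 • w + c 2 • u := fun c => by
    simp [φ, Fintype.linearCombination_apply, Fin.sum_univ_three]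
  have hmemA : ∀ c, φ c ∈ A ↔ c 2 = 0 := fun c => by
    rw [hφ, A.add_mem_iff_right (A.add_mem (A.smul_mem _ hvA) (A.smul_mem _ hwA))]
    refine ⟨fun h => ?_, fun h => by simp [h]⟩
    by_contra h0
    exact huA ((A.smul_mem_iff h0).1 h)
  have hinj : Function.Injective φ := by
    rw [← LinearMap.ker_eq_bot, LinearMap.ker_eq_bot']
    intro c hc
    have h2 : c 2 = 0 := (hmemA c).1 (by rw [hc]; exact A.zero_mem)
    rw [hφ, h2, zero_smul, add_zero] at hc
    ext i
    fin_cases i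
    exacts [(hvw _ _ hc).1, (hvw _ _ hc).2, h2]
  have hrange : finrank ℝ (LinearMap.range φ) = 3 := by
    rw [LinearMap.finrank_range_of_inj hinj, finrank_fin_fun]
  have hArange : A ≤ LinearMap.range φ := by
    rw [hspanA, span_le]
    rintro x (rfl | rfl)
    · exact ⟨![1, 0, 0], by simp [hφ]⟩
    · exact ⟨![0, 1, 0], by simp [hφ]⟩
  have hcube : ∀ c, 2 * T.toFun (φ c) (φ c) (φ c) =
      c 2 * (c ⬝ᵥ (T.residualMatrix v w u).mulVec c) := fun c => by
    rw [hφ]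
    exact hA.cube_eq_residual hvA hwA u c
  have hpoint : ∀ L, T.IsLine L → A ⊓ L = ⊥ → ∃ c, φ c ∈ L ∧ c ≠ 0 ∧ c 2 ≠ 0 ∧
      c ⬝ᵥ (T.residualMatrix v w u).mulVec c = 0 := fun L hL hAL => by
    have := inf_ne_bot_of_finrank_lt (S := L) (T := LinearMap.range φ) le_top le_top (by
      rw [finrank_top, T.finrank_eq, hL.1, hrange]; norm_num)
    obtain ⟨_, ⟨hcL, c, rfl⟩, hc0⟩ := (Submodule.ne_bot_iff _).1 this
    have hc2 : c 2 ≠ 0 := fun h =>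
      hc0 (by simpa [hAL] using (show φ c ∈ A ⊓ L from ⟨(hmemA c).2 h, hcL⟩))
    have := hcube c
    rw [hL.2 _ hcL, mul_zero, zero_eq_mul] at this
    exact ⟨c, hcL, fun h => hc0 (by rw [h, map_zero]), hc2, this.resolve_left hc2⟩
  obtain ⟨c, hcB, hc0, hc2, hc⟩ := hpoint B hB hAB
  obtain ⟨d, hdC, hd0, hd2, hd⟩ := hpoint C hC hAC
  have hnot : ¬ (c ∈ span ℝ {k} ∧ d ∈ span ℝ {k}) := fun ⟨h1, h2⟩ => by
    obtain ⟨α, rfl⟩ := mem_span_singleton.1 h1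
    obtain ⟨β, rfl⟩ := mem_span_singleton.1 h2
    rw [map_smul] at hcB hdC
    rw [B.smul_mem_iff (by rintro rfl; simp at hc0)] at hcB
    rw [C.smul_mem_iff (by rintro rfl; simp at hd0)] at hdC
    have : φ k ∈ B ⊓ C := ⟨hcB, hdC⟩
    rw [hBC, mem_bot] at this
    exact hk0 (hinj (this.trans (map_zero φ).symm))
  obtain ⟨e, hek, he2, he⟩ : ∃ e, e ∉ span ℝ {k} ∧ e 2 ≠ 0 ∧
      e ⬝ᵥ (T.residualMatrix v w u).mulVec e = 0 := by
    by_cases h : c ∈ span ℝ {k}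
    · exact ⟨d, fun h' => hnot ⟨h, h'⟩, hd2, hd⟩
    · exact ⟨c, h, hc2, hc⟩
  have hli : LinearIndependent ℝ ![k, e] := by
    rw [LinearIndependent.pair_iff' hk0]
    exact fun a ha => hek (mem_span_singleton.2 ⟨a, ha⟩)
  have hW2 : finrank ℝ ((span ℝ {k, e}).map φ) = 2 := by
    rw [← (Submodule.equivMapOfInjective φ hinj _).finrank_eq]
    have := finrank_span_eq_card hli
    rwa [Matrix.range_cons_cons_empty] at this
  have hsymm : (T.residualMatrix v w u).transpose = T.residualMatrix v w u := by
    ext i j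
    fin_cases i <;> fin_cases j <;> rfl
  refine ⟨(span ℝ {k, e}).map φ, ⟨hW2, ?_⟩, ?_, ?_⟩
  · rintro _ ⟨x, hx, rfl⟩
    obtain ⟨s, t, rfl⟩ := mem_span_pair.1 hx
    have hke : k ⬝ᵥ (T.residualMatrix v w u).mulVec e = 0 := by
      rw [Matrix.dotProduct_mulVec, ← Matrix.mulVec_transpose, hsymm, hk, zero_dotProduct]
    have := hcube (s • k + t • e)
    simpa [Matrix.mulVec_add, Matrix.mulVec_smul, hk, hke, he] using this
  · intro h
    refine he2 ((hmemA e).1 ?_)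
    rw [h]
    exact ⟨e, subset_span (by simp), rfl⟩
  · exact inf_ne_bot_of_finrank_lt hArange LinearMap.map_le_range (by
      rw [hrange, hA.1, hW2]; norm_num)

end SmoothCubicForm

namespace MvPolynomial

/-- The coefficients of the polarization of a cubic form. -/
noncomputable def polarCoeff (f : MvPolynomial (Fin 4) ℝ) (i j k : Fin 4) : ℝ :=
  coeff 0 (pderiv k (pderiv j (pderiv i f))) / 6

theorem pderiv_pderiv_comm {σ R : Type*} [CommRing R] (i j : σ) (f : MvPolynomial σ R) :
    pderiv i (pderiv j f) = pderiv j (pderiv i f) := by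
  classical
  have h : ⁅pderiv (R := R) i, pderiv (R := R) j⁆ = 0 := by
    refine derivation_ext fun l => ?_
    rw [Derivation.commutator_apply, pderiv_X, pderiv_X]
    by_cases h1 : l = i <;> by_cases h2 : l = j <;> simp [Pi.single_apply, h1, h2, apply_ite]
  have := congrArg (fun D => D f) h
  rwa [Derivation.commutator_apply, Derivation.zero_apply, sub_eq_zero] at this

theorem polarCoeff_comm_left (f : MvPolynomial (Fin 4) ℝ) (i j k : Fin 4) :
    polarCoeff f i j k = polarCoeff f j i k := by
  rw [polarCoeff, pderiv_pderiv_comm j i, polarCoeff]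

theorem polarCoeff_comm_right (f : MvPolynomial (Fin 4) ℝ) (i j k : Fin 4) :
    polarCoeff f i j k = polarCoeff f i k j := by
  rw [polarCoeff, pderiv_pderiv_comm k j, polarCoeff]

theorem IsHomogeneous.pderiv_eq_sum_polarCoeff {f : MvPolynomial (Fin 4) ℝ}
    (hf : f.IsHomogeneous 3) (i : Fin 4) :
    pderiv i f = C 3 * ∑ j, ∑ k, C (polarCoeff f i j k) * X j * X k := by
  have h0 : ∀ j k, pderiv k (pderiv j (pderiv i f)) = C (6 * polarCoeff f i j k) := fun j k => by
    have := (hf.pderiv (i := i)).pderiv (i := j) |>.pderiv (i := k)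
    rw [← totalDegree_zero_iff_isHomogeneous, totalDegree_eq_zero_iff_eq_C] at this
    rw [this, polarCoeff, mul_div_cancel₀ _ (by norm_num)]
  have h1 : ∀ j, pderiv j (pderiv i f) = C 6 * ∑ k, C (polarCoeff f i j k) * X k := fun j => by
    have := ((hf.pderiv (i := i)).pderiv (i := j)).sum_X_mul_pderiv
    simp only [h0, one_smul, Nat.reduceSub] at this
    rw [← this, Finset.mul_sum]
    refine Finset.sum_congr rfl fun k _ => ?_
    rw [map_mul]
    ring
  have h2 := (hf.pderiv (i := i)).sum_X_mul_pderiv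
  simp only [h1, Nat.reduceSub, nsmul_eq_mul, Nat.cast_ofNat] at h2
  have h3 : (C 2 : MvPolynomial (Fin 4) ℝ) * pderiv i f =
      C 2 * (C 3 * ∑ j, ∑ k, C (polarCoeff f i j k) * X j * X k) := by
    rw [show (C 2 : MvPolynomial (Fin 4) ℝ) = 2 from rfl, ← h2,
      show (C 6 : MvPolynomial (Fin 4) ℝ) = 2 * C 3 by
        rw [show (2 : MvPolynomial (Fin 4) ℝ) = C 2 from rfl, ← map_mul]; norm_num]
    simp only [Finset.mul_sum]
    refine Finset.sum_congr rfl fun j _ => Finset.sum_congr rfl fun k _ => ?_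
    ring
  exact mul_left_cancel₀ (C_ne_zero.2 two_ne_zero) h3

theorem IsHomogeneous.eq_sum_polarCoeff {f : MvPolynomial (Fin 4) ℝ} (hf : f.IsHomogeneous 3) :
    f = ∑ i, ∑ j, ∑ k, C (polarCoeff f i j k) * X i * X j * X k := by
  have h := hf.sum_X_mul_pderiv
  rw [nsmul_eq_mul, Nat.cast_ofNat] at h
  refine mul_left_cancel₀ (show (3 : MvPolynomial (Fin 4) ℝ) ≠ 0 by norm_num) ?_
  rw [← h]
  simp only [Finset.mul_sum]
  refine Finset.sum_congr rfl fun i _ => ?_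
  rw [hf.pderiv_eq_sum_polarCoeff, show (C 3 : MvPolynomial (Fin 4) ℝ) = 3 from rfl]
  simp only [Finset.mul_sum]
  refine Finset.sum_congr rfl fun j _ => Finset.sum_congr rfl fun k _ => ?_
  ring

/-- The polarization of a cubic form. -/
noncomputable def polarForm (f : MvPolynomial (Fin 4) ℝ) :
    (Fin 4 → ℝ) →ₗ[ℝ] (Fin 4 → ℝ) →ₗ[ℝ] (Fin 4 → ℝ) →ₗ[ℝ] ℝ :=
  ∑ i, ∑ j, ∑ k, (LinearMap.proj i).smulRight
    ((LinearMap.proj j).smulRight (polarCoeff f i j k • LinearMap.proj k))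

theorem polarForm_apply (f : MvPolynomial (Fin 4) ℝ) (x y z : Fin 4 → ℝ) :
    polarForm f x y z = ∑ i, ∑ j, ∑ k, polarCoeff f i j k * x i * y j * z k := by
  simp only [polarForm, LinearMap.sum_apply, LinearMap.smulRight_apply, LinearMap.proj_apply,
    LinearMap.smul_apply, smul_eq_mul]
  refine Finset.sum_congr rfl fun i _ => Finset.sum_congr rfl fun j _ =>
    Finset.sum_congr rfl fun k _ => ?_
  ring

theorem polarForm_comm_left (f : MvPolynomial (Fin 4) ℝ) (x y z : Fin 4 → ℝ) :
    polarForm f x y z = polarForm f y x z := by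
  rw [polarForm_apply, polarForm_apply, Finset.sum_comm]
  refine Finset.sum_congr rfl fun i _ => Finset.sum_congr rfl fun j _ =>
    Finset.sum_congr rfl fun k _ => ?_
  rw [polarCoeff_comm_left]
  ring

theorem polarForm_comm_right (f : MvPolynomial (Fin 4) ℝ) (x y z : Fin 4 → ℝ) :
    polarForm f x y z = polarForm f x z y := by
  rw [polarForm_apply, polarForm_apply]
  refine Finset.sum_congr rfl fun i _ => ?_
  rw [Finset.sum_comm]
  refine Finset.sum_congr rfl fun j _ => Finset.sum_congr rfl fun k _ => ?_
  rw [polarCoeff_comm_right]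
  ring

theorem IsHomogeneous.eval_eq_polarForm {f : MvPolynomial (Fin 4) ℝ} (hf : f.IsHomogeneous 3)
    (x : Fin 4 → ℝ) : eval x f = polarForm f x x x := by
  conv_lhs => rw [hf.eq_sum_polarCoeff]
  simp [polarForm_apply]

/-- The partial derivatives of a cubic form at a point `s v + t w` with `s`, `t` in an extension
field and `v`, `w` real. -/
theorem IsHomogeneous.eval_map_pderiv_eq_polarForm {f : MvPolynomial (Fin 4) ℝ}
    (hf : f.IsHomogeneous 3) {K : Type*} [Field K] [Algebra ℝ K] (s t : K) (v w : Fin 4 → ℝ)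
    (i : Fin 4) :
    eval (fun j => s * algebraMap ℝ K (v j) + t * algebraMap ℝ K (w j))
        (map (algebraMap ℝ K) (pderiv i f)) =
      3 * (s ^ 2 * algebraMap ℝ K (polarForm f v v (Pi.single i 1)) +
        2 * (s * t) * algebraMap ℝ K (polarForm f v w (Pi.single i 1)) +
        t ^ 2 * algebraMap ℝ K (polarForm f w w (Pi.single i 1))) := by
  have h : ∀ x y, polarForm f x y (Pi.single i 1) = ∑ j, ∑ k, polarCoeff f i j k * x j * y k :=
    fun x y => by
      rw [polarForm_comm_right, polarForm_comm_left, polarForm_apply]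
      simp [Pi.single_apply]
  have h' : algebraMap ℝ K (polarForm f v w (Pi.single i 1)) =
      algebraMap ℝ K (polarForm f w v (Pi.single i 1)) := by rw [polarForm_comm_left]
  rw [two_mul, add_mul]
  nth_rw 2 [h']
  simp only [h, hf.pderiv_eq_sum_polarCoeff i, map_mul, map_sum, map_C, map_X, eval_C, eval_X,
    map_ofNat, Finset.mul_sum, ← Finset.sum_add_distrib]
  refine Finset.sum_congr rfl fun j _ => Finset.sum_congr rfl fun k _ => ?_
  ring

end MvPolynomial

theorem exists_isotropic_of_isAlgClosed {K : Type*} [Field K] [IsAlgClosed K] (a b c : K) :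
    ∃ s t : K, (s ≠ 0 ∨ t ≠ 0) ∧ s ^ 2 * a + 2 * (s * t) * b + t ^ 2 * c = 0 := by
  by_cases ha : a = 0
  · exact ⟨1, 0, .inl one_ne_zero, by simp [ha]⟩
  · obtain ⟨r, hr⟩ := IsAlgClosed.exists_pow_nat_eq (b ^ 2 - a * c) (n := 2) (by norm_num)
    refine ⟨r - b, a, .inr ha, ?_⟩
    linear_combination a * hr

namespace IsSmoothCubic

variable {f : MvPolynomial (Fin 4) ℝ}

/-- A point of the real line through `v` and `w`, with coordinates in the algebraic closure, is
smooth: the gradient of `f` does not vanish there. -/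
theorem not_forall_polarForm_eq_zero (hf : IsSmoothCubic ℝ f) {v w : Fin 4 → ℝ}
    (hvw : LinearIndependent ℝ ![v, w]) {s t : AlgebraicClosure ℝ} (hst : s ≠ 0 ∨ t ≠ 0) :
    ¬ ∀ y, s ^ 2 * algebraMap ℝ (AlgebraicClosure ℝ) (polarForm f v v y) +
        2 * (s * t) * algebraMap ℝ (AlgebraicClosure ℝ) (polarForm f v w y) +
        t ^ 2 * algebraMap ℝ (AlgebraicClosure ℝ) (polarForm f w w y) = 0 := by
  intro h
  set x : Fin 4 → AlgebraicClosure ℝ := fun j =>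
    s * algebraMap ℝ (AlgebraicClosure ℝ) (v j) + t * algebraMap ℝ (AlgebraicClosure ℝ) (w j)
    with hx
  have hgrad : ∀ i, eval x (map (algebraMap ℝ (AlgebraicClosure ℝ)) (pderiv i f)) = 0 :=
    fun i => by
      rw [hx, hf.2.1.eval_map_pderiv_eq_polarForm, h, mul_zero]
  have hval : eval x (map (algebraMap ℝ (AlgebraicClosure ℝ)) f) = 0 := by
    have := congrArg (fun g => eval x (map (algebraMap ℝ (AlgebraicClosure ℝ)) g))
      hf.2.1.sum_X_mul_pderiv
    simpa [hgrad] using this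
  have hx0 := hf.2.2 x ⟨hval, hgrad⟩
  rw [LinearIndependent.pair_iff] at hvw
  have hminor : ∀ i j, v i * w j = v j * w i := fun i j => by
    have hi := congrFun hx0 i
    have hj := congrFun hx0 j
    simp only [hx, Pi.zero_apply] at hi hj
    refine (algebraMap ℝ (AlgebraicClosure ℝ)).injective ?_
    rw [map_mul, map_mul]
    rcases hst with h | h
    · refine mul_left_cancel₀ h ?_
      linear_combination algebraMap ℝ (AlgebraicClosure ℝ) (w j) * hi -
        algebraMap ℝ (AlgebraicClosure ℝ) (w i) * hj
    · refine mul_left_cancel₀ h ?_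
      linear_combination algebraMap ℝ (AlgebraicClosure ℝ) (v i) * hj -
        algebraMap ℝ (AlgebraicClosure ℝ) (v j) * hi
  have hv : v = 0 := by
    ext i
    have := hvw (w i) (-v i) (by
      ext j
      simp only [Pi.add_apply, Pi.smul_apply, smul_eq_mul, Pi.zero_apply]
      linear_combination -(hminor i j))
    simpa using this.2
  simpa using (hvw 1 0 (by simp [hv])).1

theorem eq_zero_of_polarForm_eq_zero (hf : IsSmoothCubic ℝ f) (x : Fin 4 → ℝ)
    (h : polarForm f x x = 0) : x = 0 := by
  by_contra hx
  obtain ⟨a, ha⟩ := exists_linearIndependent_pair_of_one_lt_finrank (R := ℝ)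
    (by rw [finrank_fin_fun]; norm_num) hx
  exact hf.not_forall_polarForm_eq_zero ha (s := 1) (t := 0) (.inl one_ne_zero)
    fun y => by simp [h]

theorem mem_of_polarForm_eq_zero (hf : IsSmoothCubic ℝ f) (A : Submodule ℝ (Fin 4 → ℝ))
    (b : Fin 4 → ℝ) (hA : finrank ℝ A = 2) (hA0 : ∀ x ∈ A, polarForm f x x x = 0)
    (h : ∀ x ∈ A, ∀ y ∈ A, polarForm f x y b = 0) : b ∈ A := by
  by_contra hb
  obtain ⟨v, hvA, hv0⟩ := (Submodule.ne_bot_iff A).1 fun h0 => by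
    rw [h0, finrank_bot] at hA
    norm_num at hA
  obtain ⟨w, hwA, hvw, -⟩ := exists_coordinates_of_finrank_eq_two hA hvA hv0
  have h1 : A < A ⊔ span ℝ {b} := left_lt_sup.2 fun hle => hb (hle (mem_span_singleton_self b))
  have h1' := Submodule.finrank_lt_finrank_of_lt h1
  obtain ⟨z, hz⟩ : ∃ z, z ∉ A ⊔ span ℝ {b} := by
    by_contra! hall
    have h2 := Submodule.finrank_add_le_finrank_add_finrank A (span ℝ {b})
    have h3 := finrank_span_le_card (R := ℝ) ({b} : Set (Fin 4 → ℝ))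
    rw [eq_top_iff'.2 hall, finrank_top, finrank_fin_fun, hA] at h2
    simp only [Set.toFinset_singleton, Finset.card_singleton] at h3
    omega
  have h2 : A ⊔ span ℝ {b} < A ⊔ span ℝ {b} ⊔ span ℝ {z} :=
    left_lt_sup.2 fun hle => hz (hle (mem_span_singleton_self z))
  have h2' := Submodule.finrank_lt_finrank_of_lt h2
  have htop : A ⊔ span ℝ {b} ⊔ span ℝ {z} = ⊤ := by
    refine eq_top_of_finrank_eq (le_antisymm (Submodule.finrank_le _) ?_)
    rw [finrank_fin_fun]
    omega
  obtain ⟨s, t, hst, hz0⟩ := exists_isotropic_of_isAlgClosed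
    (algebraMap ℝ (AlgebraicClosure ℝ) (polarForm f v v z))
    (algebraMap ℝ (AlgebraicClosure ℝ) (polarForm f v w z))
    (algebraMap ℝ (AlgebraicClosure ℝ) (polarForm f w w z))
  refine hf.not_forall_polarForm_eq_zero hvw hst fun y => ?_
  obtain ⟨_, hy, y3, hy3, rfl⟩ := mem_sup.1 (htop ▸ mem_top : y ∈ A ⊔ span ℝ {b} ⊔ span ℝ {z})
  obtain ⟨y1, hy1, y2, hy2, rfl⟩ := mem_sup.1 hy
  obtain ⟨β, rfl⟩ := mem_span_singleton.1 hy2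
  obtain ⟨γ, rfl⟩ := mem_span_singleton.1 hy3
  have hp : ∀ x ∈ A, ∀ y ∈ A, polarForm f x y (y1 + β • b + γ • z) = γ * polarForm f x y z :=
    fun x hx y hy => by
      rw [map_add, map_add, map_smul, map_smul, h x hx y hy, trilinear_eq_zero_of_cube_eq_zero
        (polarForm_comm_left f) (polarForm_comm_right f) hA0 hx hy hy1]
      simp
  rw [hp v hvA v hvA, hp v hvA w hwA, hp w hwA w hwA, map_mul, map_mul, map_mul]
  linear_combination algebraMap ℝ (AlgebraicClosure ℝ) γ * hz0

/-- A smooth cubic surface over `ℝ`, as a symmetric trilinear form. -/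
noncomputable def toSmoothCubicForm (hf : IsSmoothCubic ℝ f) : SmoothCubicForm (Fin 4 → ℝ) where
  toFun := polarForm f
  comm_left := polarForm_comm_left f
  comm_right := polarForm_comm_right f
  finrank_eq := finrank_fin_fun ℝ
  eq_zero_of_tangent := hf.eq_zero_of_polarForm_eq_zero
  mem_of_tangent_along := hf.mem_of_polarForm_eq_zero

theorem isLineOn_iff (hf : IsSmoothCubic ℝ f) (W : Submodule ℝ (Fin 4 → ℝ)) :
    IsLineOn f W ↔ hf.toSmoothCubicForm.IsLine W := by
  have heval : ∀ (v w : Fin 4 → ℝ) (c : Fin 2 → ℝ),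
      eval c (lineRestrict f v w) = polarForm f (c 0 • v + c 1 • w) (c 0 • v + c 1 • w)
        (c 0 • v + c 1 • w) := fun v w c => by
    rw [← hf.2.1.eval_eq_polarForm, lineRestrict, ← aeval_eq_eval, ← aeval_eq_eval,
      comp_aeval_apply]
    congr 2
    ext i
    simp [mul_comm]
  refine and_congr_right fun h2 => ⟨?_, fun h => ?_⟩
  · rintro ⟨v, w, rfl, h0⟩ x hx
    obtain ⟨a, b, rfl⟩ := mem_span_pair.1 hx
    have := heval v w ![a, b]
    rw [h0, map_zero] at this
    exact this.symm
  · obtain ⟨v, hvA, hv0⟩ := (Submodule.ne_bot_iff W).1 fun h0 => by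
      rw [h0, finrank_bot] at h2
      norm_num at h2
    obtain ⟨w, hwA, -, hspan⟩ := exists_coordinates_of_finrank_eq_two h2 hvA hv0
    refine ⟨v, w, hspan.symm, MvPolynomial.funext fun c => ?_⟩
    rw [heval, map_zero]
    exact h _ (W.add_mem (W.smul_mem _ hvA) (W.smul_mem _ hwA))

end IsSmoothCubic

/-- a real smooth cubic surface with exactly seven real lines has
intersection graph the friendship graph `F₃`. -/
theorem seven_real_lines_friendship_graph (f : MvPolynomial (Fin 4) ℝ)
    (hf : IsSmoothCubic ℝ f)
    (hfin : {W : Submodule ℝ (Fin 4 → ℝ) | IsLineOn f W}.Finite)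
    (hcard : {W : Submodule ℝ (Fin 4 → ℝ) | IsLineOn f W}.ncard = 7) :
    ∃ L : Fin 7 → Submodule ℝ (Fin 4 → ℝ),
      Function.Injective L ∧
      (∀ W : Submodule ℝ (Fin 4 → ℝ), IsLineOn f W ↔ ∃ i : Fin 7, W = L i) ∧
      (∀ i j : Fin 7, i ≠ j →
        (L i ⊓ L j ≠ ⊥ ↔
          (i = 0 ∨ j = 0 ∨ (i = 1 ∧ j = 2) ∨ (i = 2 ∧ j = 1) ∨
            (i = 3 ∧ j = 4) ∨ (i = 4 ∧ j = 3) ∨ (i = 5 ∧ j = 6) ∨ (i = 6 ∧ j = 5)))) := by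
  set T := hf.toSmoothCubicForm
  have hset : {W : Submodule ℝ (Fin 4 → ℝ) | IsLineOn f W} = {W | T.IsLine W} :=
    Set.ext hf.isLineOn_iff
  rw [hset] at hfin hcard
  have : Fintype {W // T.IsLine W} := hfin.fintype
  have hα : Fintype.card {W // T.IsLine W} = 7 := by
    rw [← Nat.card_eq_fintype_card, ← hcard]
    rfl
  have hne : ∃ A B, T.lineGraph.Adj A B := by
    by_contra! hno
    let e := (Fintype.equivFinOfCardEq hα).symm
    have hskew : ∀ i j, i ≠ j → (e i).1 ⊓ (e j).1 = ⊥ := fun i j hij => by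
      by_contra h
      exact hno _ _ ⟨e.injective.ne hij, h⟩
    obtain ⟨W, hW, h1, h2⟩ := (e 0).2.exists_inf_ne_bot (e 1).2 (e 2).2 (hskew 0 1 (by decide))
      (hskew 0 2 (by decide)) (hskew 1 2 (by decide))
    exact hno (e 0) ⟨W, hW⟩ ⟨fun h => h1 (congrArg Subtype.val h), h2⟩
  obtain ⟨L, hL⟩ := exists_friendship_enumeration hα T.lineGraph
    (fun A B h => SmoothCubicForm.exists_triangle A B h) hne
  refine ⟨fun i => (L i).1, Subtype.val_injective.comp L.injective, fun W => ?_,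
    fun i j hij => ?_⟩
  · rw [hf.isLineOn_iff]
    refine ⟨fun h => ⟨L.symm ⟨W, h⟩, by simp⟩, ?_⟩
    rintro ⟨i, rfl⟩
    exact (L i).2
  · rw [← hL i j hij]
    exact (and_iff_right (L.injective.ne hij)).symm
end
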